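/- Let k be a positive integer with k ≡ 0 (mod 4). Then the restriction map π_1 : J_{k,1}(O_K) → J_{k,1} is surjective, and the map φ ↦ χ_{2,2} − (2πi/(k+2))χ'_{1,1} + ((2πi)²/(2(k+1)(k+2)))χ''_{0,0} − 6(χ_{4,0} + χ_{0,4}) restricts to an isomorphism from ker π_1 onto S_{k+4}. In particular there is an exact sequence 0 → S_{k+4} → J_{k,1}(O_K) → J_{k,1} → 0. -/

import Mathlib

noncomputable section

open Complex

/-- `τ` lies in the upper half plane. -/
def UHP (τ : ℂ) : Prop := 0 < τ.im

/-- `eC w = exp(2 π i w)`. -/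
def eC (w : ℂ) : ℂ := Complex.exp (2 * (Real.pi : ℂ) * Complex.I * w)

/-- Entries of a matrix in `SL(2, ℤ)`, as complex numbers. -/
def Ma (M : Matrix.SpecialLinearGroup (Fin 2) ℤ) : ℂ := ((M.1 0 0 : ℤ) : ℂ)
def Mb (M : Matrix.SpecialLinearGroup (Fin 2) ℤ) : ℂ := ((M.1 0 1 : ℤ) : ℂ)
def Mc (M : Matrix.SpecialLinearGroup (Fin 2) ℤ) : ℂ := ((M.1 1 0 : ℤ) : ℂ)
def Md (M : Matrix.SpecialLinearGroup (Fin 2) ℤ) : ℂ := ((M.1 1 1 : ℤ) : ℂ)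

/-- Hermitian Jacobi form of weight `k` and index `m` for the Hermitian Jacobi group over
`ℤ[i]`.  A form is a function `φ : ℂ → ℂ → ℂ → ℂ`, all conditions being imposed for `τ`
in the upper half plane.  Units `ε ∈ ℤ[i]ˣ = {1, -1, i, -i}`, and the elliptic variables
`λ = p + q i`, `μ = u + v i` range over `ℤ[i]`.  The Fourier expansion is indexed by
`n ∈ ℕ` and `r = (a + b i)/2 ∈ O_K^♯ = (i/2)ℤ[i]`, supported on `N(r) ≤ n m`,
i.e. `a² + b² ≤ 4 n m`. -/
structure IsHJF (k m : ℕ) (φ : ℂ → ℂ → ℂ → ℂ) : Prop where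
  holo : DifferentiableOn ℂ (fun p : ℂ × ℂ × ℂ => φ p.1 p.2.1 p.2.2) {p | UHP p.1}
  transf : ∀ ε : ℂ, ε ∈ ({1, -1, Complex.I, -Complex.I} : Set ℂ) →
    ∀ M : Matrix.SpecialLinearGroup (Fin 2) ℤ, ∀ τ z₁ z₂ : ℂ, UHP τ →
      φ ((Ma M * τ + Mb M) / (Mc M * τ + Md M))
        (ε * z₁ / (Mc M * τ + Md M))
        ((starRingEnd ℂ) ε * z₂ / (Mc M * τ + Md M))
      = ε ^ k * (Mc M * τ + Md M) ^ k *
          eC ((m : ℂ) * Mc M * z₁ * z₂ / (Mc M * τ + Md M)) * φ τ z₁ z₂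
  ellip : ∀ p q u v : ℤ, ∀ τ z₁ z₂ : ℂ, UHP τ →
      φ τ (z₁ + ((p : ℂ) + (q : ℂ) * Complex.I) * τ + ((u : ℂ) + (v : ℂ) * Complex.I))
          (z₂ + ((p : ℂ) - (q : ℂ) * Complex.I) * τ + ((u : ℂ) - (v : ℂ) * Complex.I))
      = eC (-(m : ℂ) * (((p : ℂ) ^ 2 + (q : ℂ) ^ 2) * τ
          + ((p : ℂ) - (q : ℂ) * Complex.I) * z₁
          + ((p : ℂ) + (q : ℂ) * Complex.I) * z₂)) * φ τ z₁ z₂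
  fourier : ∃ c : ℕ → ℤ → ℤ → ℂ,
      (∀ (n : ℕ) (a b : ℤ), 4 * (n : ℤ) * m < a ^ 2 + b ^ 2 → c n a b = 0) ∧
      ∀ τ z₁ z₂ : ℂ, UHP τ →
        HasSum (fun p : ℕ × ℤ × ℤ => c p.1 p.2.1 p.2.2 *
          eC ((p.1 : ℂ) * τ + (((p.2.1 : ℂ) + (p.2.2 : ℂ) * Complex.I) / 2) * z₁
            + (((p.2.1 : ℂ) - (p.2.2 : ℂ) * Complex.I) / 2) * z₂)) (φ τ z₁ z₂)

/-- Classical Jacobi form of weight `k` and index `m` for `SL(2,ℤ) ⋉ ℤ²`. -/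
structure IsJF (k m : ℕ) (φ : ℂ → ℂ → ℂ) : Prop where
  holo : DifferentiableOn ℂ (fun p : ℂ × ℂ => φ p.1 p.2) {p | UHP p.1}
  transf : ∀ M : Matrix.SpecialLinearGroup (Fin 2) ℤ, ∀ τ z : ℂ, UHP τ →
      φ ((Ma M * τ + Mb M) / (Mc M * τ + Md M)) (z / (Mc M * τ + Md M))
      = (Mc M * τ + Md M) ^ k *
          eC ((m : ℂ) * Mc M * z ^ 2 / (Mc M * τ + Md M)) * φ τ z
  ellip : ∀ p q : ℤ, ∀ τ z : ℂ, UHP τ →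
      φ τ (z + (p : ℂ) * τ + (q : ℂ))
      = eC (-(m : ℂ) * ((p : ℂ) ^ 2 * τ + 2 * (p : ℂ) * z)) * φ τ z
  fourier : ∃ c : ℕ → ℤ → ℂ,
      (∀ (n : ℕ) (r : ℤ), 4 * (n : ℤ) * m < r ^ 2 → c n r = 0) ∧
      ∀ τ z : ℂ, UHP τ →
        HasSum (fun p : ℕ × ℤ => c p.1 p.2 * eC ((p.1 : ℂ) * τ + (p.2 : ℂ) * z)) (φ τ z)

/-- Modular form of weight `k` for `SL(2,ℤ)`. -/
structure IsMF (k : ℕ) (f : ℂ → ℂ) : Prop where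
  holo : DifferentiableOn ℂ f {τ | UHP τ}
  transf : ∀ M : Matrix.SpecialLinearGroup (Fin 2) ℤ, ∀ τ : ℂ, UHP τ →
      f ((Ma M * τ + Mb M) / (Mc M * τ + Md M)) = (Mc M * τ + Md M) ^ k * f τ
  bounded : ∃ A B : ℝ, ∀ τ : ℂ, B ≤ τ.im → ‖f τ‖ ≤ A

/-- Cusp form of weight `k` for `SL(2,ℤ)`. -/
structure IsCF (k : ℕ) (f : ℂ → ℂ) : Prop where
  holo : DifferentiableOn ℂ f {τ | UHP τ}
  transf : ∀ M : Matrix.SpecialLinearGroup (Fin 2) ℤ, ∀ τ : ℂ, UHP τ →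
      f ((Ma M * τ + Mb M) / (Mc M * τ + Md M)) = (Mc M * τ + Md M) ^ k * f τ
  decay : ∀ ε : ℝ, 0 < ε → ∃ B : ℝ, ∀ τ : ℂ, B ≤ τ.im → ‖f τ‖ ≤ ε

/-- `M_w(SL(2,ℤ), ω̄)` for the character `ω` of `SL(2,ℤ)` with `ω(T) = ω(S) = i`:
holomorphic functions on the upper half plane, bounded at infinity, with
`f|_w T = -i f` and `f|_w S = -i f`. -/
structure IsMFOmegaBar (w : ℕ) (f : ℂ → ℂ) : Prop where
  holo : DifferentiableOn ℂ f {τ | UHP τ}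
  transT : ∀ τ : ℂ, UHP τ → f (τ + 1) = -Complex.I * f τ
  transS : ∀ τ : ℂ, UHP τ → f (-1 / τ) = -Complex.I * τ ^ w * f τ
  bounded : ∃ A B : ℝ, ∀ τ : ℂ, B ≤ τ.im → ‖f τ‖ ≤ A

/-- Hermitian theta function `θ^H_{m,s}` of index `m` with characteristic
`s = (a + b i)/2 ∈ O_K^♯`; the sum is over `r = s + m (g₁ + g₂ i) ∈ s + m ℤ[i]`. -/
def thetaH (m : ℕ) (a b : ℤ) (τ z₁ z₂ : ℂ) : ℂ :=
  ∑' g : ℤ × ℤ,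
    eC ((((a : ℂ) + 2 * m * g.1) ^ 2 + ((b : ℂ) + 2 * m * g.2) ^ 2) / (4 * m) * τ
      + (((a : ℂ) + 2 * m * g.1) + ((b : ℂ) + 2 * m * g.2) * Complex.I) / 2 * z₁
      + (((a : ℂ) + 2 * m * g.1) - ((b : ℂ) + 2 * m * g.2) * Complex.I) / 2 * z₂)

/-- Classical theta function `θ_{m,μ}(τ,z) = Σ_{r ≡ μ mod 2m} e(r²τ/(4m) + r z)`. -/
def thetaJ (m : ℕ) (μ : ℤ) (τ z : ℂ) : ℂ :=
  ∑' g : ℤ, eC (((μ : ℂ) + 2 * m * g) ^ 2 / (4 * m) * τ + ((μ : ℂ) + 2 * m * g) * z)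

/-- `h` is the family of theta components of `φ` (for index `m`): the `h_{a,b}` depend
only on `(a, b) mod 2m` and `φ = Σ_{s ∈ O_K^♯ / m O_K} h_s θ^H_{m,s}`. -/
def HasThetaDecomp (m : ℕ) (φ : ℂ → ℂ → ℂ → ℂ) (h : ℤ → ℤ → ℂ → ℂ) : Prop :=
  (∀ (a b : ℤ) (τ : ℂ), h (a + 2 * m) b τ = h a b τ ∧ h a (b + 2 * m) τ = h a b τ) ∧
  ∀ τ z₁ z₂ : ℂ, UHP τ →
    φ τ z₁ z₂ = ∑ a ∈ Finset.range (2 * m), ∑ b ∈ Finset.range (2 * m),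
      h (a : ℤ) (b : ℤ) τ * thetaH m (a : ℤ) (b : ℤ) τ z₁ z₂

/-- `ϑ₀(τ) = Σ_{r ∈ ℤ} e(r² τ)`. -/
def theta0C (τ : ℂ) : ℂ := ∑' r : ℤ, eC ((r : ℂ) ^ 2 * τ)

/-- `ϑ₁(τ) = Σ_{r odd} e(r² τ / 4)`. -/
def theta1C (τ : ℂ) : ℂ := ∑' r : ℤ, eC ((2 * (r : ℂ) + 1) ^ 2 * τ / 4)

/-- `ξ = ϑ₁ ϑ₀' − ϑ₀ ϑ₁'`. -/
def xiC (τ : ℂ) : ℂ := theta1C τ * deriv theta0C τ - theta0C τ * deriv theta1C τ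

/-- Taylor coefficient `χ_{α,β}(τ)` of `φ(τ, z₁, z₂)` around `z₁ = z₂ = 0`. -/
def chiHJF (φ : ℂ → ℂ → ℂ → ℂ) (α β : ℕ) (τ : ℂ) : ℂ :=
  (1 / ((α.factorial : ℂ) * (β.factorial : ℂ))) *
    iteratedDeriv α (fun z₁ => iteratedDeriv β (fun z₂ => φ τ z₁ z₂) 0) 0

/-- `D₀ : J_{k,m} → M_k`, `ψ ↦ ψ(·, 0)`. -/
def D0J (ψ : ℂ → ℂ → ℂ) : ℂ → ℂ := fun τ => ψ τ 0

/-- `D₂ : J_{k,m} → S_{k+2}`, `D₂ψ = (2k/(2πi)²) ψ₂ − (2m/(2πi)) ψ₀'`, where `ψ_ν` are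
the Taylor coefficients of `ψ` around `z = 0`. -/
def D2J (k m : ℕ) (ψ : ℂ → ℂ → ℂ) : ℂ → ℂ := fun τ =>
  (2 * (k : ℂ) / (2 * (Real.pi : ℂ) * Complex.I) ^ 2) *
      ((1 / 2) * iteratedDeriv 2 (fun z => ψ τ z) 0)
    - (2 * (m : ℂ) / (2 * (Real.pi : ℂ) * Complex.I)) * deriv (fun t => ψ t 0) τ

/-- Normalized Eisenstein series `E₄`. -/
def E4C (τ : ℂ) : ℂ :=
  1 + 240 * ∑' n : ℕ, ((ArithmeticFunction.sigma 3) n : ℂ) * eC ((n : ℂ) * τ)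

/-- Normalized Eisenstein series `E₆`. -/
def E6C (τ : ℂ) : ℂ :=
  1 - 504 * ∑' n : ℕ, ((ArithmeticFunction.sigma 5) n : ℂ) * eC ((n : ℂ) * τ)

/-- `f` agrees on the upper half plane with a polynomial in `E₄` and `E₆²` that is
homogeneous of weight `k - v`, i.e. supported on `4a + 12b + v = k`. -/
def IsE4E6sqPoly (v k : ℕ) (f : ℂ → ℂ) : Prop :=
  ∃ lam : ℕ × ℕ → ℂ, ∀ τ : ℂ, UHP τ →
    f τ = ∑ p ∈ (Finset.range (k + 1) ×ˢ Finset.range (k + 1)).filter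
        (fun p => 4 * p.1 + 12 * p.2 + v = k),
      lam p * E4C τ ^ p.1 * E6C τ ^ (2 * p.2)

/-- The slash action `φ|_{k,m} M` of `M ∈ SL(2,ℤ)` on functions `ℂ → ℂ → ℂ → ℂ`. -/
def slashHJF (k m : ℕ) (φ : ℂ → ℂ → ℂ → ℂ) (M : Matrix.SpecialLinearGroup (Fin 2) ℤ)
    (τ z₁ z₂ : ℂ) : ℂ :=
  ((Mc M * τ + Md M) ^ k)⁻¹ *
    eC (-(m : ℂ) * Mc M * z₁ * z₂ / (Mc M * τ + Md M)) *
    φ ((Ma M * τ + Mb M) / (Mc M * τ + Md M)) (z₁ / (Mc M * τ + Md M)) (z₂ / (Mc M * τ + Md M))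

/-- Hermitian Jacobi form of weight `k` and index `m` for the congruence subgroup `Γ₀(N)`,
with at each cusp a Fourier expansion supported on `(n, r) ∈ ℚ_{≥0} × O_K^♯`
with `N(r) ≤ n m`. -/
structure IsHJFLevel (k m N : ℕ) (φ : ℂ → ℂ → ℂ → ℂ) : Prop where
  holo : DifferentiableOn ℂ (fun p : ℂ × ℂ × ℂ => φ p.1 p.2.1 p.2.2) {p | UHP p.1}
  transf : ∀ ε : ℂ, ε ∈ ({1, -1, Complex.I, -Complex.I} : Set ℂ) →
    ∀ M : Matrix.SpecialLinearGroup (Fin 2) ℤ, (N : ℤ) ∣ M.1 1 0 →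
    ∀ τ z₁ z₂ : ℂ, UHP τ →
      φ ((Ma M * τ + Mb M) / (Mc M * τ + Md M))
        (ε * z₁ / (Mc M * τ + Md M))
        ((starRingEnd ℂ) ε * z₂ / (Mc M * τ + Md M))
      = ε ^ k * (Mc M * τ + Md M) ^ k *
          eC ((m : ℂ) * Mc M * z₁ * z₂ / (Mc M * τ + Md M)) * φ τ z₁ z₂
  ellip : ∀ p q u v : ℤ, ∀ τ z₁ z₂ : ℂ, UHP τ →
      φ τ (z₁ + ((p : ℂ) + (q : ℂ) * Complex.I) * τ + ((u : ℂ) + (v : ℂ) * Complex.I))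
          (z₂ + ((p : ℂ) - (q : ℂ) * Complex.I) * τ + ((u : ℂ) - (v : ℂ) * Complex.I))
      = eC (-(m : ℂ) * (((p : ℂ) ^ 2 + (q : ℂ) ^ 2) * τ
          + ((p : ℂ) - (q : ℂ) * Complex.I) * z₁
          + ((p : ℂ) + (q : ℂ) * Complex.I) * z₂)) * φ τ z₁ z₂
  cusp : ∀ M : Matrix.SpecialLinearGroup (Fin 2) ℤ,
      ∃ c : ℚ → ℤ → ℤ → ℂ,
        (∀ (n : ℚ) (a b : ℤ),
          ¬ (0 ≤ n ∧ ((a : ℚ) ^ 2 + (b : ℚ) ^ 2) ≤ 4 * n * m) → c n a b = 0) ∧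
        ∀ τ z₁ z₂ : ℂ, UHP τ →
          HasSum (fun p : ℚ × ℤ × ℤ => c p.1 p.2.1 p.2.2 *
            eC ((p.1 : ℂ) * τ + (((p.2.1 : ℂ) + (p.2.2 : ℂ) * Complex.I) / 2) * z₁
              + (((p.2.1 : ℂ) - (p.2.2 : ℂ) * Complex.I) / 2) * z₂))
            (slashHJF k m φ M τ z₁ z₂)

/-- Theta constant `x`. -/
def thConstX (τ : ℂ) : ℂ := ∑' n : ℤ, eC ((n : ℂ) ^ 2 * τ / 2)

/-- Theta constant `y`. -/
def thConstY (τ : ℂ) : ℂ := ∑' n : ℤ, (-1 : ℂ) ^ n * eC ((n : ℂ) ^ 2 * τ / 2)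

/-- Theta constant `z`. -/
def thConstZ (τ : ℂ) : ℂ := ∑' n : ℤ, eC (((n : ℂ) + 1 / 2) ^ 2 * τ / 2)

/-- The map `φ ↦ χ_{2,2} − (2πi/(k+2))χ'_{1,1} + ((2πi)²/(2(k+1)(k+2)))χ''_{0,0}
 − 6(χ_{4,0} + χ_{0,4})` on Hermitian Jacobi forms. -/
def XiMap (k : ℕ) (φ : ℂ → ℂ → ℂ → ℂ) : ℂ → ℂ := fun τ =>
  chiHJF φ 2 2 τ
    - (2 * (Real.pi : ℂ) * Complex.I / ((k : ℂ) + 2)) * deriv (chiHJF φ 1 1) τ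
    + ((2 * (Real.pi : ℂ) * Complex.I) ^ 2 / (2 * ((k : ℂ) + 1) * ((k : ℂ) + 2))) *
        deriv (deriv (chiHJF φ 0 0)) τ
    - 6 * (chiHJF φ 4 0 τ + chiHJF φ 0 4 τ)


open Filter Topology

lemma eC_add (x y : ℂ) : eC (x + y) = eC x * eC y := by
  simp only [eC, mul_add, Complex.exp_add]

lemma eC_zero : eC 0 = 1 := by simp [eC]

lemma eC_ne_zero (x : ℂ) : eC x ≠ 0 := Complex.exp_ne_zero _

lemma eC_neg (x : ℂ) : eC (-x) = (eC x)⁻¹ := by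
  simp only [eC, mul_neg, Complex.exp_neg]

lemma eC_int (n : ℤ) : eC (n : ℂ) = 1 := by
  rw [eC, Complex.exp_eq_one_iff]; exact ⟨n, by ring⟩

lemma eC_add_int (x : ℂ) (n : ℤ) : eC (x + n) = eC x := by
  rw [eC_add, eC_int, mul_one]

lemma eC_diff : Differentiable ℂ eC := by unfold eC; fun_prop

@[fun_prop]
lemma DifferentiableAt.eC' {E : Type*} [NormedAddCommGroup E] [NormedSpace ℂ E] {f : E → ℂ}
    {x : E} (hf : DifferentiableAt ℂ f x) : DifferentiableAt ℂ (fun y => eC (f y)) x := by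
  unfold eC; fun_prop

@[fun_prop]
lemma DifferentiableOn.eC' {E : Type*} [NormedAddCommGroup E] [NormedSpace ℂ E] {f : E → ℂ}
    {s : Set E} (hf : DifferentiableOn ℂ f s) : DifferentiableOn ℂ (fun y => eC (f y)) s := by
  unfold eC; fun_prop

@[fun_prop]
lemma Differentiable.eC' {E : Type*} [NormedAddCommGroup E] [NormedSpace ℂ E] {f : E → ℂ}
    (hf : Differentiable ℂ f) : Differentiable ℂ (fun y => eC (f y)) := by
  unfold eC; fun_prop

lemma norm_eC (x : ℂ) : ‖eC x‖ = Real.exp (-2 * Real.pi * x.im) := by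
  rw [eC, Complex.norm_exp]; congr 1
  simp

/-- Second Taylor coefficient at zero. -/
def c2 (F : ℂ → ℂ) : ℂ := deriv (deriv F) 0 / 2

lemma diff_deriv {F : ℂ → ℂ} (h : Differentiable ℂ F) : Differentiable ℂ (deriv F) := by
  intro x
  exact ((h.differentiableOn (s := Set.univ)).deriv isOpen_univ).differentiableAt univ_mem

lemma c2_add {F G : ℂ → ℂ} (hF : Differentiable ℂ F) (hG : Differentiable ℂ G) :
    c2 (fun u => F u + G u) = c2 F + c2 G := by
  have h1 : deriv (fun u => F u + G u) = fun u => deriv F u + deriv G u := by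
    ext u; exact deriv_fun_add (hF u) (hG u)
  rw [c2, h1, deriv_fun_add (diff_deriv hF 0) (diff_deriv hG 0), c2, c2]; ring

lemma c2_mul {F G : ℂ → ℂ} (hF : Differentiable ℂ F) (hG : Differentiable ℂ G) :
    c2 (fun u => F u * G u) = c2 F * G 0 + deriv F 0 * deriv G 0 + F 0 * c2 G := by
  have h1 : deriv (fun u => F u * G u) = fun u => deriv F u * G u + F u * deriv G u := by
    ext u; exact deriv_fun_mul (hF u) (hG u)
  rw [c2, h1, deriv_fun_add ((diff_deriv hF 0).fun_mul (hG 0)) ((hF 0).fun_mul (diff_deriv hG 0)),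
    deriv_fun_mul (diff_deriv hF 0) (hG 0), deriv_fun_mul (hF 0) (diff_deriv hG 0), c2, c2]; ring

lemma c2_const_mul {F : ℂ → ℂ} (c : ℂ) : c2 (fun u => c * F u) = c * c2 F := by
  have h1 : deriv (fun u => c * F u) = fun u => c * deriv F u := by
    ext u; exact deriv_const_mul_field c
  rw [c2, h1, deriv_const_mul_field, c2]; ring

lemma c2_comp_mul {F : ℂ → ℂ} (c : ℂ) : c2 (fun u => F (c * u)) = c ^ 2 * c2 F := by
  have h1 : deriv (fun u => F (c * u)) = fun u => c * deriv F (c * u) := by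
    ext u; simpa using deriv_comp_mul_left c F u
  have h2 := deriv_comp_mul_left c (deriv F) 0
  simp only [mul_zero, smul_eq_mul] at h2
  rw [c2, h1, deriv_const_mul_field, h2, c2]; ring

lemma deriv_eC_sq (κ : ℂ) (u : ℂ) : deriv (fun u => eC (κ * u ^ 2)) u =
    (4 * Real.pi * I * κ) * u * eC (κ * u ^ 2) := by
  have : HasDerivAt (fun u : ℂ => eC (κ * u ^ 2))
      (eC (κ * u ^ 2) * (2 * Real.pi * I * (κ * (2 * u)))) u := by
    unfold eC
    have h := ((hasDerivAt_pow 2 u).const_mul κ).const_mul (2 * (Real.pi : ℂ) * I)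
    simpa using h.cexp
  rw [this.deriv]; ring

lemma c2_eC_sq (κ : ℂ) : c2 (fun u => eC (κ * u ^ 2)) = 2 * Real.pi * I * κ := by
  have h1 : deriv (fun u => eC (κ * u ^ 2)) = fun u =>
      ((4 * Real.pi * I * κ) * u) * eC (κ * u ^ 2) := by
    ext u; exact deriv_eC_sq κ u
  rw [c2, h1, deriv_fun_mul (by fun_prop) (by fun_prop), deriv_eC_sq, deriv_const_mul_field]
  simp [eC_zero]; ring

lemma deriv_even {F : ℂ → ℂ} (h : ∀ u, F (-u) = F u) : deriv F 0 = 0 := by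
  have := deriv_comp_neg F 0
  rw [show (fun x => F (-x)) = F from funext h] at this
  simp at this
  linear_combination this / 2

/-- Index one quasi-periodic entire functions. -/
structure Idx (τ : ℂ) (F : ℂ → ℂ) : Prop where
  diff : Differentiable ℂ F
  per : ∀ u, F (u + 1) = F u
  qper : ∀ u, F (u + τ) = eC (-τ - 2 * u) * F u

lemma Idx.add {τ : ℂ} {F G : ℂ → ℂ} (hF : Idx τ F) (hG : Idx τ G) : Idx τ (fun u => F u + G u) :=
  ⟨hF.diff.add hG.diff, fun u => by simp only [hF.per, hG.per],
    fun u => by simp only [hF.qper, hG.qper]; ring⟩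

lemma Idx.smul {τ : ℂ} {F : ℂ → ℂ} (c : ℂ) (hF : Idx τ F) : Idx τ (fun u => c * F u) :=
  ⟨hF.diff.const_mul c, fun u => by simp only [hF.per],
    fun u => by simp only [hF.qper]; ring⟩

/-- Fourier coefficient. -/
def fC (F : ℂ → ℂ) (a : ℤ) : ℂ := ∫ x in (0 : ℝ)..1, F x * eC (-(a : ℂ) * x)

lemma per_shift {f : ℂ → ℂ} (hf : Differentiable ℂ f) (hp : ∀ u, f (u + 1) = f u) (s : ℂ) :
    ∫ x in (0 : ℝ)..1, f (x + s) = ∫ x in (0 : ℝ)..1, f x := by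
  have h := Complex.integral_boundary_rect_eq_zero_of_differentiableOn f 0 (1 + s.im * I)
    hf.differentiableOn
  simp only [zero_re, add_re, one_re, mul_re, ofReal_re, I_re, mul_zero, ofReal_im, I_im, mul_one,
    sub_self, add_zero, zero_im, ofReal_zero, zero_mul, add_im, one_im, mul_im, zero_add,
    ofReal_one] at h
  have h2 : ∀ y : ℝ, f (1 + y * I) = f (y * I) := fun y => by rw [add_comm, hp]
  simp only [h2] at h
  have hper : Function.Periodic (fun x : ℝ => f (x + s.im * I)) 1 := by
    intro x
    simp only [ofReal_add, ofReal_one]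
    rw [← hp (x + s.im * I)]; ring_nf
  have h3 := hper.intervalIntegral_add_eq s.re 0
  have h5 := intervalIntegral.integral_comp_add_right (a := 0) (b := 1)
    (fun x : ℝ => f (x + s.im * I)) s.re
  rw [zero_add, add_comm 1] at h5
  rw [← h5] at h3
  simp only [zero_add] at h3
  have h4 : ∫ x in (0 : ℝ)..1, f (x + s) = ∫ x in (0 : ℝ)..1, f (x + s.im * I) := by
    rw [← h3]
    congr 1; ext x; congr 1
    nth_rewrite 1 [← re_add_im s]; push_cast; ring
  rw [h4]; linear_combination -h

lemma fC_shift {τ : ℂ} {F : ℂ → ℂ} (hF : Idx τ F) (a : ℤ) :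
    fC F a = eC (-((a : ℂ) + 1) * τ) * fC F (a + 2) := by
  have hd : Differentiable ℂ (fun u => F u * eC (-(a : ℂ) * u)) := by
    have := hF.diff; fun_prop
  have h := per_shift hd (fun u => by
    rw [hF.per, show -(a : ℂ) * (u + 1) = -(a : ℂ) * u + ((-a : ℤ) : ℂ) by push_cast; ring,
      eC_add_int]) τ
  rw [fC, ← h, fC, ← intervalIntegral.integral_const_mul]
  congr 1; ext x
  rw [hF.qper]
  rw [show eC (-τ - 2 * x) * F x * eC (-(a : ℂ) * (x + τ)) =
    F x * (eC (-τ - 2 * x) * eC (-(a : ℂ) * (x + τ))) by ring,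
    show eC (-((a : ℂ) + 1) * τ) * (F x * eC (-((a + 2 : ℤ) : ℂ) * x)) =
    F x * (eC (-((a : ℂ) + 1) * τ) * eC (-((a + 2 : ℤ) : ℂ) * x)) by ring, ← eC_add, ← eC_add]
  congr 2; push_cast; ring

lemma fC_all {τ : ℂ} {F : ℂ → ℂ} (hF : Idx τ F) (h0 : fC F 0 = 0) (h1 : fC F 1 = 0) (a : ℤ) :
    fC F a = 0 := by
  have step : ∀ a, fC F a = 0 ↔ fC F (a + 2) = 0 := fun a => by
    rw [fC_shift hF a]; simp [eC_ne_zero]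
  have key : ∀ n : ℤ, fC F n = 0 ∧ fC F (n + 1) = 0 := by
    intro n
    induction n using Int.induction_on with
    | zero => exact ⟨h0, by simpa using h1⟩
    | succ i ih => exact ⟨ih.2, by rw [add_assoc]; exact (step _).1 ih.1⟩
    | pred i ih =>
      refine ⟨(step _).2 ?_, by simpa using ih.1⟩
      convert ih.2 using 2; ring
  exact (key a).1

lemma zero_of_fC {F : ℂ → ℂ} (hd : Differentiable ℂ F) (hp : ∀ u, F (u + 1) = F u)
    (h : ∀ a, fC F a = 0) : ∀ u, F u = 0 := by
  have hper : Function.Periodic (fun x : ℝ => F x) (1 : ℝ) := fun x => by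
    simpa using hp x
  have hc : Continuous hper.lift := by
    apply Continuous.quotient_lift
    exact hd.continuous.comp continuous_ofReal
  have : Fact ((0 : ℝ) < 1) := ⟨one_pos⟩
  let f : C(AddCircle (1 : ℝ), ℂ) := ⟨hper.lift, hc⟩
  have hco : ∀ n, fourierCoeff f n = 0 := by
    intro n
    rw [fourierCoeff_eq_intervalIntegral f n 0]
    have := h n
    rw [fC] at this
    simp only [zero_add, one_div, inv_one, one_smul]
    rw [← this]
    congr 1; ext x
    rw [fourier_coe_apply, smul_eq_mul, mul_comm]
    congr 1
    rw [eC]; congr 1; push_cast; ring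
  have hs := hasSum_fourier_series_of_summable (f := f) (by
    rw [show (fourierCoeff (f : AddCircle (1:ℝ) → ℂ)) = fun _ => 0 from funext hco]; exact summable_zero)
  simp only [hco, zero_smul] at hs
  have hf0 : f = 0 := hs.unique hasSum_zero
  have hreal : ∀ x : ℝ, F x = 0 := fun x => by
    have := congrArg (fun g : C(AddCircle (1 : ℝ), ℂ) => g (x : AddCircle (1:ℝ))) hf0
    simpa [f] using this
  have han : AnalyticOnNhd ℂ F Set.univ := hd.differentiableOn.analyticOnNhd isOpen_univ
  have hz := han.eqOn_zero_of_preconnected_of_frequently_eq_zero isPreconnected_univ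
    (Set.mem_univ (0 : ℂ)) (by
      have ht : Tendsto (fun n : ℕ => (((1 : ℝ) / ((n : ℝ) + 1) : ℝ) : ℂ)) atTop (𝓝[≠] (0 : ℂ)) := by
        rw [tendsto_nhdsWithin_iff]
        constructor
        · have := (continuous_ofReal.tendsto 0).comp tendsto_one_div_add_atTop_nhds_zero_nat
          simpa [Function.comp_def] using this
        · filter_upwards with n
          simp only [Set.mem_compl_iff, Set.mem_singleton_iff, ofReal_eq_zero]
          positivity
      refine ht.frequently (Frequently.of_forall fun n => hreal _))
  intro u; exact hz (Set.mem_univ u)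

/-- If there are index one functions `A`, `B` normalised at zero, they span. -/
lemma Idx.span {τ : ℂ} {F A B : ℂ → ℂ} (hF : Idx τ F) (hA : Idx τ A) (hB : Idx τ B)
    (hA0 : A 0 = 0) (hA2 : c2 A = 1) (hB0 : B 0 = 1) (hB2 : c2 B = 0) (u : ℂ) :
    F u = F 0 * B u + c2 F * A u := by
  set G : ℂ → ℂ := fun u => F u + (-F 0 * B u + -c2 F * A u) with hG
  have hGi : Idx τ G := hF.add ((hB.smul _).add (hA.smul _))
  have hG0 : G 0 = 0 := by simp [hG, hA0, hB0]
  have hG2 : c2 G = 0 := by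
    rw [hG, c2_add hF.diff ((hB.smul _).add (hA.smul _)).diff,
      c2_add (hB.smul _).diff (hA.smul _).diff, c2_const_mul, c2_const_mul, hA2, hB2]; ring
  obtain ⟨v, hv, hv0⟩ : ∃ v : Fin 3 → ℂ, v ≠ 0 ∧
      (Matrix.of ![![fC G 0, fC A 0, fC B 0], ![fC G 1, fC A 1, fC B 1]]).mulVec v = 0 := by
    by_contra! hcon
    have hinj : Function.Injective (Matrix.toLin' (Matrix.of ![![fC G 0, fC A 0, fC B 0],
        ![fC G 1, fC A 1, fC B 1]])) := by
      rw [injective_iff_map_eq_zero]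
      intro a ha
      by_contra hne
      exact hcon a hne (by simpa using ha)
    have := LinearMap.finrank_le_finrank_of_injective hinj
    simp at this
  have e0 := congrFun hv0 0
  have e1 := congrFun hv0 1
  simp [Matrix.mulVec, dotProduct, Fin.sum_univ_three] at e0 e1
  have hH : Idx τ (fun u => v 0 * G u + (v 1 * A u + v 2 * B u)) :=
    (hGi.smul _).add ((hA.smul _).add (hB.smul _))
  have hfc : ∀ a, fC (fun u => v 0 * G u + (v 1 * A u + v 2 * B u)) a =
      fC G a * v 0 + fC A a * v 1 + fC B a * v 2 := by
    intro a
    have ii : ∀ {F : ℂ → ℂ}, Idx τ F → IntervalIntegrable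
        (fun x : ℝ => F x * eC (-(a : ℂ) * x)) MeasureTheory.volume 0 1 := by
      intro F hF
      apply Continuous.intervalIntegrable
      have := hF.diff.continuous
      have := eC_diff.continuous
      fun_prop
    simp only [fC]
    rw [← intervalIntegral.integral_mul_const, ← intervalIntegral.integral_mul_const,
      ← intervalIntegral.integral_mul_const, ← intervalIntegral.integral_add
      ((ii hGi).mul_const _) ((ii hA).mul_const _), ← intervalIntegral.integral_add
      (((ii hGi).mul_const _).add ((ii hA).mul_const _)) ((ii hB).mul_const _)]
    congr 1; ext x; ring
  have hz := zero_of_fC hH.diff hH.per (fC_all hH (by rw [hfc, e0]) (by rw [hfc, e1]))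
  have z2 : v 2 = 0 := by simpa [hG0, hA0, hB0] using hz 0
  have z1 : v 1 = 0 := by
    have : c2 (fun u => v 0 * G u + (v 1 * A u + v 2 * B u)) = 0 := by
      rw [show (fun u => v 0 * G u + (v 1 * A u + v 2 * B u)) = fun _ => 0 from funext hz]
      simp [c2]
    rw [c2_add (hGi.smul _).diff ((hA.smul _).add (hB.smul _)).diff,
      c2_add (hA.smul _).diff (hB.smul _).diff, c2_const_mul, c2_const_mul, c2_const_mul, hA2, hB2,
      hG2] at this
    simpa using this
  have z0 : v 0 ≠ 0 := by
    intro h; apply hv; ext i; fin_cases i <;> simp [h, z1, z2]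
  have hGu : G u = 0 := by
    have := hz u
    simpa [z1, z2, z0] using this
  rw [hG] at hGu; linear_combination hGu

open Filter Topology

/-- The filter of points with imaginary part tending to infinity. -/
def imInf : Filter ℂ := Filter.comap Complex.im atTop

lemma imInf_ge (B : ℝ) : ∀ᶠ τ in imInf, B ≤ τ.im :=
  (eventually_ge_atTop B).comap Complex.im

instance : imInf.NeBot := by
  unfold imInf
  rw [comap_neBot_iff_frequently]
  exact Frequently.of_forall (fun y => ⟨y * I, by simp⟩)

lemma imInf_UHP : ∀ᶠ τ in imInf, UHP τ := by
  filter_upwards [imInf_ge 1] with τ h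
  exact lt_of_lt_of_le one_pos h

lemma isOpen_UHP : IsOpen {τ : ℂ | UHP τ} := isOpen_lt continuous_const Complex.continuous_im

lemma qs_tendsto {ι : Type*} (c : ι → ℂ) (n : ι → ℕ)
    (hs : Summable (fun i => ‖c i * eC (n i * I)‖)) :
    Tendsto (fun τ => ∑' i, c i * eC (n i * τ)) imInf (𝓝 (∑' i, if n i = 0 then c i else 0)) := by
  apply tendsto_tsum_of_dominated_convergence hs
  · intro i
    by_cases h : n i = 0
    · simp [h, eC_zero]
    · simp only [h, if_false]
      rw [tendsto_zero_iff_norm_tendsto_zero]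
      simp only [norm_mul, norm_eC]
      have : Tendsto (fun τ : ℂ => -2 * Real.pi * ((n i : ℂ) * τ).im) imInf atBot := by
        have h1 : (fun τ : ℂ => -2 * Real.pi * ((n i : ℂ) * τ).im) =
          fun τ => (-(2 * Real.pi * n i)) * τ.im := by ext τ; simp; ring
        rw [h1]
        apply Tendsto.const_mul_atTop_of_neg
        · have : 0 < (n i : ℝ) := by positivity
          have := Real.pi_pos
          simp; positivity
        · exact tendsto_comap
      simpa using (Real.tendsto_exp_atBot.comp this).const_mul ‖c i‖
  · filter_upwards [imInf_ge 1] with τ hτ i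
    rw [norm_mul, norm_mul, norm_eC, norm_eC]
    apply mul_le_mul_of_nonneg_left _ (norm_nonneg _)
    rw [Real.exp_le_exp]
    simp
    have : (0:ℝ) ≤ n i := by positivity
    have := Real.pi_pos
    have : 2 * Real.pi * (n i : ℝ) * 1 ≤ 2 * Real.pi * (n i : ℝ) * τ.im := by gcongr
    linarith

lemma qs_diff {ι : Type*} (c : ι → ℂ) (n : ι → ℕ)
    (hs : ∀ y : ℝ, 0 < y → Summable (fun i => ‖c i‖ * Real.exp (-2 * Real.pi * (n i * y)))) :
    DifferentiableOn ℂ (fun τ => ∑' i, c i * eC (n i * τ)) {τ | UHP τ} := by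
  intro τ hτ
  have hτ' : 0 < τ.im := hτ
  have ho : IsOpen {t : ℂ | τ.im / 2 < t.im} := isOpen_lt continuous_const Complex.continuous_im
  have := differentiableOn_tsum_of_summable_norm (F := fun i t => c i * eC (n i * t))
    (hs (τ.im / 2) (by positivity)) (U := {t : ℂ | τ.im / 2 < t.im})
    (fun i => by fun_prop) ho
    (fun i t ht => by
      rw [norm_mul, norm_eC]
      apply mul_le_mul_of_nonneg_left _ (norm_nonneg _)
      rw [Real.exp_le_exp]
      simp
      simp at ht
      have : (0:ℝ) ≤ n i := by positivity
      have := Real.pi_pos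
      have : 2 * Real.pi * (n i : ℝ) * (τ.im / 2) ≤ 2 * Real.pi * (n i : ℝ) * t.im := by gcongr
      linarith)
  exact (this.differentiableAt (ho.mem_nhds (by simp; linarith))).differentiableWithinAt

/-- normalised theta functions -/
def Tt (a : ℤ) (τ u : ℂ) : ℂ := ∑' g : ℤ, eC (((g : ℂ) ^ 2 + a * g) * τ + (2 * g + a) * u)

lemma Tt_term (a g : ℤ) (τ u : ℂ) : eC (((g : ℂ) ^ 2 + a * g) * τ + (2 * g + a) * u) =
    eC (a * u) * jacobiTheta₂_term g (2 * u + a * τ) (2 * τ) := by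
  simp only [eC, jacobiTheta₂_term]
  rw [← Complex.exp_add]; congr 1; ring

lemma Tt_eq (a : ℤ) (τ u : ℂ) : Tt a τ u = eC (a * u) * jacobiTheta₂ (2 * u + a * τ) (2 * τ) := by
  simp only [Tt, Tt_term, tsum_mul_left, jacobiTheta₂]

lemma Tt_hasSum (a : ℤ) {τ : ℂ} (hτ : UHP τ) (u : ℂ) :
    HasSum (fun g : ℤ => eC (((g : ℂ) ^ 2 + a * g) * τ + (2 * g + a) * u)) (Tt a τ u) := by
  simp only [Tt_term, Tt_eq]
  apply HasSum.mul_left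
  apply hasSum_jacobiTheta₂_term
  simpa [UHP] using hτ

lemma Tt_holo (a : ℤ) {p : ℂ × ℂ} (hτ : UHP p.1) :
    DifferentiableAt ℂ (fun p : ℂ × ℂ => Tt a p.1 p.2) p := by
  simp only [Tt_eq]
  have h := (hasFDerivAt_jacobiTheta₂ (2 * p.2 + a * p.1) (τ := 2 * p.1) (by simpa [UHP] using hτ)).differentiableAt
  have h2 : DifferentiableAt ℂ (fun p : ℂ × ℂ => jacobiTheta₂ (2 * p.2 + a * p.1) (2 * p.1)) p :=
    DifferentiableAt.comp (f := fun p : ℂ × ℂ => ((2 * p.2 + a * p.1 : ℂ), (2 * p.1 : ℂ))) p h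
      (by fun_prop)
  fun_prop

lemma Tt_idx (a : ℤ) {τ : ℂ} (hτ : UHP τ) : Idx τ (Tt a τ) where
  diff := fun u => (Tt_holo a (p := (τ, u)) hτ).comp (f := fun u => (τ, u)) u (by fun_prop)
  per u := by
    rw [Tt_eq, Tt_eq, show 2 * (u + 1) + a * τ = (2 * u + a * τ) + 1 + 1 by ring,
      jacobiTheta₂_add_left, jacobiTheta₂_add_left, mul_add, mul_one, eC_add_int]
  qper u := by
    rw [Tt_eq, Tt_eq, show 2 * (u + τ) + a * τ = (2 * u + a * τ) + 2 * τ by ring,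
      jacobiTheta₂_add_left']
    rw [← mul_assoc, ← mul_assoc, ← eC_add]
    congr 1
    rw [eC, eC, ← Complex.exp_add]; congr 1; ring

lemma Tt_T (a : ℤ) (τ u : ℂ) : Tt a (τ + 1) u = Tt a τ u := by
  unfold Tt; congr 1; ext g
  rw [show ((g : ℂ) ^ 2 + a * g) * (τ + 1) + (2 * g + a) * u =
    ((g : ℂ) ^ 2 + a * g) * τ + (2 * g + a) * u + ((g ^ 2 + a * g : ℤ) : ℂ) by push_cast; ring,
    eC_add_int]

lemma Tt_even (a : ℤ) (τ u : ℂ) : Tt a τ (-u) = Tt a τ u := by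
  unfold Tt
  rw [← (Equiv.subLeft (-a)).tsum_eq]
  congr 1; ext g
  congr 1
  simp; ring

/-- exponent as natural number -/
def ex (a g : ℤ) : ℕ := (g ^ 2 + a * g).toNat

lemma ex_nonneg {a : ℤ} (ha : a = 0 ∨ a = 1) (g : ℤ) : 0 ≤ g ^ 2 + a * g := by
  rcases ha with rfl | rfl
  · nlinarith
  · rcases le_or_gt 0 g with h | h <;> nlinarith

lemma ex_cast {a : ℤ} (ha : a = 0 ∨ a = 1) (g : ℤ) : (ex a g : ℤ) = g ^ 2 + a * g :=
  Int.toNat_of_nonneg (ex_nonneg ha g)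

lemma ex_castC {a : ℤ} (ha : a = 0 ∨ a = 1) (g : ℤ) : (ex a g : ℂ) = (g : ℂ) ^ 2 + a * g := by
  have := ex_cast ha g
  exact_mod_cast congrArg (Int.cast (R := ℂ)) this

lemma bound_summable {a : ℤ} (ha : a = 0 ∨ a = 1) (k : ℕ) {y : ℝ} (hy : 0 < y) :
    Summable (fun g : ℤ => |(2 * (g : ℝ) + a)| ^ k * Real.exp (-2 * Real.pi * (ex a g * y))) := by
  have h := fun j => summable_pow_mul_jacobiTheta₂_term_bound y (T := 2 * y) (by positivity) j
  have h' := ((h k).add (h 0)).mul_left ((3 : ℝ) ^ k)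
  refine Summable.of_nonneg_of_le (fun g => by positivity) (fun g => ?_) h'
  have hb : |(2 * (g : ℝ) + a)| ^ k ≤ 3 ^ k * (|(g : ℝ)| ^ k + |(g : ℝ)| ^ 0) := by
    have ha1 : |(a : ℝ)| ≤ 1 := by rcases ha with rfl | rfl <;> simp
    have h1 : |(2 * (g : ℝ) + a)| ≤ 2 * |(g : ℝ)| + 1 := by
      calc _ ≤ |2 * (g : ℝ)| + |(a : ℝ)| := abs_add_le _ _
        _ ≤ _ := by rw [abs_mul]; simp; exact ha1
    rcases eq_or_ne g 0 with rfl | hg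
    · have : |(2 * ((0:ℤ) : ℝ) + a)| ^ k ≤ 1 := pow_le_one₀ (abs_nonneg _) (by simpa using ha1)
      have h3 : (1 : ℝ) ≤ 3 ^ k := one_le_pow₀ (by norm_num)
      have : (0:ℝ) ≤ |((0:ℤ) : ℝ)| ^ k := by positivity
      simp only [pow_zero]
      nlinarith
    · have hg1 : (1 : ℝ) ≤ |(g : ℝ)| := by exact_mod_cast Int.one_le_abs hg
      have : |(2 * (g : ℝ) + a)| ^ k ≤ (3 * |(g : ℝ)|) ^ k := by gcongr; linarith
      rw [mul_pow] at this
      have h3 : (0 : ℝ) ≤ 3 ^ k := by positivity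
      simp only [pow_zero]
      nlinarith
  have hE : Real.exp (-2 * Real.pi * (ex a g * y)) ≤
      Real.exp (-Real.pi * (2 * y * (g:ℝ) ^ 2 - 2 * y * |(g:ℝ)|)) := by
    rw [Real.exp_le_exp]
    have hex : (ex a g : ℝ) = (g : ℝ) ^ 2 + a * g := by exact_mod_cast congrArg (Int.cast (R := ℝ)) (ex_cast ha g)
    rw [hex]
    have : -|(g : ℝ)| ≤ a * g := by
      rcases ha with rfl | rfl
      · simp
      · simp [neg_abs_le]
    have hpy : 0 < Real.pi * y := by have := Real.pi_pos; positivity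
    nlinarith
  refine (mul_le_mul hb hE (Real.exp_pos _).le (by positivity)).trans (le_of_eq ?_)
  push_cast
  ring

open Filter Topology

/-- exponential series are differentiable termwise -/
lemma expser_deriv {ι : Type*} (c l : ι → ℂ)
    (hs : ∀ R : ℝ, 0 ≤ R → Summable (fun i => ‖c i‖ * Real.exp (‖l i‖ * R))) :
    (deriv (fun u => ∑' i, c i * Complex.exp (l i * u)) =
      fun u => ∑' i, (c i * l i) * Complex.exp (l i * u)) ∧
    (∀ R : ℝ, 0 ≤ R → Summable (fun i => ‖c i * l i‖ * Real.exp (‖l i‖ * R))) := by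
  constructor
  · ext u
    have h := Complex.hasSum_deriv_of_summable_norm (F := fun i u => c i * Complex.exp (l i * u))
      (hs (‖u‖ + 1) (by positivity)) (U := Metric.ball 0 (‖u‖ + 1)) (fun i => by fun_prop)
      Metric.isOpen_ball (fun i w hw => by
        rw [norm_mul]
        apply mul_le_mul_of_nonneg_left _ (norm_nonneg _)
        rw [Complex.norm_exp, Real.exp_le_exp]
        refine (Complex.re_le_norm _).trans ?_
        rw [norm_mul]
        simp at hw
        gcongr) (z := u) (by simp)
    rw [← h.tsum_eq]
    congr 1; ext i
    have : HasDerivAt (fun u => c i * Complex.exp (l i * u)) (c i * (Complex.exp (l i * u) * (l i * 1))) u :=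
      (((hasDerivAt_id u).const_mul (l i)).cexp).const_mul (c i)
    rw [this.deriv]; ring
  · intro R hR
    refine Summable.of_nonneg_of_le (fun i => by positivity) (fun i => ?_) (hs (R + 1) (by positivity))
    rw [norm_mul, mul_assoc, mul_add, Real.exp_add, mul_one, mul_comm (Real.exp _)]
    gcongr
    linarith [Real.add_one_le_exp ‖l i‖]

/-- second Taylor coefficient of the theta functions -/
def tc (a : ℤ) (τ : ℂ) : ℂ :=
  ∑' g : ℤ, ((2 * Real.pi * I * (2 * g + a)) ^ 2 / 2) * eC ((ex a g : ℂ) * τ)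

lemma c2_Tt {a : ℤ} (ha : a = 0 ∨ a = 1) {τ : ℂ} (hτ : UHP τ) : c2 (Tt a τ) = tc a τ := by
  have hT : Tt a τ = fun u => ∑' g : ℤ, eC ((ex a g : ℂ) * τ) *
      Complex.exp ((2 * Real.pi * I * (2 * g + a)) * u) := by
    ext u; rw [Tt]; congr 1; ext g
    rw [eC_add, ex_castC ha]
    congr 1
    rw [eC]; congr 1; ring
  have hs : ∀ R : ℝ, 0 ≤ R → Summable (fun g : ℤ => ‖eC ((ex a g : ℂ) * τ)‖ *
      Real.exp (‖(2 * Real.pi * I * (2 * g + a) : ℂ)‖ * R)) := by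
    intro R hR
    have h1 := ((Tt_hasSum a hτ (I * R)).summable.norm).add ((Tt_hasSum a hτ (-(I * R))).summable.norm)
    refine Summable.of_nonneg_of_le (fun g => by positivity) (fun g => ?_) h1
    rw [eC_add, eC_add, ex_castC ha, norm_mul (eC _) (eC _), norm_mul (eC _) (eC _), ← mul_add]
    apply mul_le_mul_of_nonneg_left _ (norm_nonneg _)
    rw [norm_eC, norm_eC]
    have e1 : ((2 * (g : ℂ) + a) * (I * R)).im = (2 * g + a) * R := by simp
    have e2 : ((2 * (g : ℂ) + a) * (-(I * R))).im = -((2 * g + a) * R) := by simp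
    have e3 : ‖(2 * Real.pi * I * (2 * g + a) : ℂ)‖ = 2 * Real.pi * |2 * (g : ℝ) + a| := by
      rw [norm_mul, norm_mul, norm_mul]
      have : ‖(2 * (g : ℂ) + a)‖ = |2 * (g : ℝ) + a| := by
        rw [← Real.norm_eq_abs, ← Complex.norm_real]; push_cast; rfl
      rw [this]; simp [abs_of_pos Real.pi_pos]
    rw [e1, e2, e3]
    rcases abs_cases (2 * (g : ℝ) + a) with ⟨h, _⟩ | ⟨h, _⟩
    · rw [h]
      have : 0 < Real.exp (-2 * Real.pi * ((2 * g + a) * R)) := Real.exp_pos _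
      have e : 2 * Real.pi * (2 * (g:ℝ) + a) * R = -2 * Real.pi * -((2 * g + a) * R) := by ring
      rw [e]; linarith
    · rw [h]
      have : 0 < Real.exp (-2 * Real.pi * -((2 * g + a) * R)) := Real.exp_pos _
      have e : 2 * Real.pi * -(2 * (g:ℝ) + a) * R = -2 * Real.pi * ((2 * g + a) * R) := by ring
      rw [e]; linarith
  obtain ⟨d1, hs1⟩ := expser_deriv _ _ hs
  obtain ⟨d2, -⟩ := expser_deriv _ _ hs1
  rw [c2, hT, d1, d2, tc, ← tsum_div_const]
  congr 1; ext g; simp; ring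

lemma tc_sum {a : ℤ} (ha : a = 0 ∨ a = 1) {y : ℝ} (hy : 0 < y) :
    Summable (fun g : ℤ => ‖((2 * Real.pi * I * (2 * g + a)) ^ 2 / 2 : ℂ)‖ *
      Real.exp (-2 * Real.pi * (ex a g * y))) := by
  have := (bound_summable ha 2 hy).mul_left ((2 * Real.pi) ^ 2 / 2)
  refine this.congr (fun g => ?_)
  rw [norm_div, norm_pow, norm_mul, norm_mul, norm_mul]
  have h2 : ‖(2 * (g : ℂ) + a)‖ = |2 * (g : ℝ) + a| := by
    rw [← Real.norm_eq_abs, ← Complex.norm_real]; push_cast; rfl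
  rw [h2]; simp [abs_of_pos Real.pi_pos, -sq_abs]; ring

lemma tc_diff {a : ℤ} (ha : a = 0 ∨ a = 1) : DifferentiableOn ℂ (tc a) {τ | UHP τ} :=
  qs_diff _ _ (fun _ hy => tc_sum ha hy)

lemma tc_T (a : ℤ) (τ : ℂ) : tc a (τ + 1) = tc a τ := by
  unfold tc; congr 1; ext g
  rw [mul_add (_ : ℂ) τ 1, mul_one, show ((ex a g : ℕ) : ℂ) = ((ex a g : ℤ) : ℂ) by simp, eC_add_int]

lemma ex_zero_iff0 (g : ℤ) : ex 0 g = 0 ↔ g = 0 := by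
  zify; rw [ex_cast (Or.inl rfl)]; simp

lemma ex_zero_iff1 (g : ℤ) : ex 1 g = 0 ↔ g = 0 ∨ g = -1 := by
  zify; rw [ex_cast (Or.inr rfl)]
  rw [show g ^ 2 + 1 * g = g * (g + 1) by ring, mul_eq_zero]
  omega

lemma tsum_ex0 (c : ℤ → ℂ) : (∑' g : ℤ, if ex 0 g = 0 then c g else 0) = c 0 := by
  simp only [ex_zero_iff0]; exact tsum_ite_eq 0 c

lemma tsum_ex1 (c : ℤ → ℂ) : (∑' g : ℤ, if ex 1 g = 0 then c g else 0) = c 0 + c (-1) := by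
  simp only [ex_zero_iff1]
  rw [tsum_eq_sum (s := {0, -1})]
  · rw [Finset.sum_pair (by norm_num)]; simp
  · intro g hg
    simp at hg; simp [hg]

lemma qs_tendsto' {a : ℤ} (c : ℤ → ℂ)
    (hs : Summable (fun g : ℤ => ‖c g‖ * Real.exp (-2 * Real.pi * (ex a g * (1 : ℝ))))) :
    Tendsto (fun τ => ∑' g, c g * eC (ex a g * τ)) imInf (𝓝 (∑' i, if ex a i = 0 then c i else 0)) := by
  apply qs_tendsto
  refine hs.congr fun g => ?_
  rw [norm_mul, norm_eC]; simp

lemma tc_lim0 : Tendsto (tc 0) imInf (𝓝 0) := by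
  have := qs_tendsto' _ (tc_sum (a := 0) (Or.inl rfl) one_pos)
  rw [tsum_ex0] at this
  unfold tc
  simpa using this

lemma tc_lim1 : Tendsto (tc 1) imInf (𝓝 ((2 * Real.pi * I) ^ 2)) := by
  have := qs_tendsto' _ (tc_sum (a := 1) (Or.inr rfl) one_pos)
  rw [tsum_ex1] at this
  have e : (2 * Real.pi * I : ℂ) ^ 2 = (2 * Real.pi * I * (2 * (0 : ℤ) + (1 : ℤ))) ^ 2 / 2 +
      (2 * Real.pi * I * (2 * (-1 : ℤ) + (1 : ℤ))) ^ 2 / 2 := by push_cast; ring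
  rw [e]; exact this

lemma Tt0_q {a : ℤ} (ha : a = 0 ∨ a = 1) : (fun τ => Tt a τ 0) = fun τ => ∑' g : ℤ, 1 * eC (ex a g * τ) := by
  ext τ; rw [Tt]; congr 1; ext g; rw [ex_castC ha]; simp

lemma Tt0_sum {a : ℤ} (ha : a = 0 ∨ a = 1) {y : ℝ} (hy : 0 < y) :
    Summable (fun g : ℤ => ‖(1 : ℂ)‖ * Real.exp (-2 * Real.pi * (ex a g * y))) := by
  refine (bound_summable ha 0 hy).congr (fun g => by simp)

lemma Tt0_lim0 : Tendsto (fun τ => Tt 0 τ 0) imInf (𝓝 1) := by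
  rw [Tt0_q (Or.inl rfl)]
  have := qs_tendsto' _ (Tt0_sum (a := 0) (Or.inl rfl) one_pos)
  rwa [tsum_ex0] at this

lemma Tt0_lim1 : Tendsto (fun τ => Tt 1 τ 0) imInf (𝓝 2) := by
  rw [Tt0_q (Or.inr rfl)]
  have := qs_tendsto' _ (Tt0_sum (a := 1) (Or.inr rfl) one_pos)
  rw [tsum_ex1] at this
  convert this using 2; norm_num

lemma Tt_half0 (τ : ℂ) : Tt 0 τ (1 / 2) = Tt 0 τ 0 := by
  unfold Tt; congr 1; ext g
  rw [show ((g : ℂ) ^ 2 + (0 : ℤ) * g) * τ + (2 * g + (0 : ℤ)) * (1 / 2) =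
    ((g : ℂ) ^ 2 + (0 : ℤ) * g) * τ + (2 * g + (0 : ℤ)) * 0 + g by push_cast; ring, eC_add_int]

lemma eC_half : eC (1 / 2) = -1 := by
  rw [eC, ← Complex.exp_pi_mul_I]; congr 1; ring

lemma Tt_half1 (τ : ℂ) : Tt 1 τ (1 / 2) = - Tt 1 τ 0 := by
  unfold Tt; rw [← tsum_neg]; congr 1; ext g
  rw [show ((g : ℂ) ^ 2 + (1 : ℤ) * g) * τ + (2 * g + (1 : ℤ)) * (1 / 2) =
    ((g : ℂ) ^ 2 + (1 : ℤ) * g) * τ + (2 * g + (1 : ℤ)) * 0 + 1 / 2 + g by push_cast; ring, eC_add_int,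
    eC_add _ (1 / 2), eC_half]
  ring

lemma Tt0_diff (a : ℤ) (u : ℂ) : DifferentiableOn ℂ (fun τ => Tt a τ u) {τ | UHP τ} := fun τ hτ =>
  ((Tt_holo a (p := (τ, u)) hτ).comp (f := fun τ => (τ, u)) τ (by fun_prop)).differentiableWithinAt

/-- Wronskian -/
def wr (τ : ℂ) : ℂ := Tt 0 τ 0 * tc 1 τ - Tt 1 τ 0 * tc 0 τ

lemma wr_diff : DifferentiableOn ℂ wr {τ | UHP τ} :=
  ((Tt0_diff 0 0).mul (tc_diff (Or.inr rfl))).sub ((Tt0_diff 1 0).mul (tc_diff (Or.inl rfl)))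

lemma wr_T (τ : ℂ) : wr (τ + 1) = wr τ := by simp only [wr, Tt_T, tc_T]

lemma wr_lim : Tendsto wr imInf (𝓝 ((2 * Real.pi * I) ^ 2)) := by
  have := (Tt0_lim0.mul tc_lim1).sub (Tt0_lim1.mul tc_lim0)
  unfold wr
  simpa using this

open Filter Topology

lemma hasSum_int_even_odd {f : ℤ → ℂ} {m m' : ℂ} (he : HasSum (fun k => f (2 * k)) m)
    (ho : HasSum (fun k => f (2 * k + 1)) m') : HasSum f (m + m') := by
  have := mul_right_injective₀ (two_ne_zero' ℤ)
  replace ho := ((add_left_injective 1).comp this).hasSum_range_iff.2 ho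
  refine (this.hasSum_range_iff.2 he).add_isCompl ?_ ho
  have e1 : Set.range (fun k : ℤ => 2 * k) = {n | Even n} := by
    ext n; simp [even_iff_exists_two_mul]
  have e2 : Set.range ((fun a : ℤ => a + 1) ∘ fun k : ℤ => 2 * k) = {n | Odd n} := by
    ext n; simp [Odd, eq_comm]
  rw [e1, e2]
  exact Int.isCompl_even_odd

lemma UHP_S {τ : ℂ} (hτ : UHP τ) : UHP (-1 / τ) := by
  have h0 : τ ≠ 0 := by rintro rfl; simp [UHP] at hτ
  simp only [UHP] at *
  rw [Complex.div_im]; simp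
  apply div_neg_of_neg_of_pos (by linarith); exact Complex.normSq_pos.mpr h0

lemma UHP_ne {τ : ℂ} (hτ : UHP τ) : τ ≠ 0 := by rintro rfl; simp [UHP] at hτ

lemma jac_split {τ : ℂ} (hτ : UHP τ) (u : ℂ) :
    jacobiTheta₂ u (τ / 2) = Tt 0 τ u + eC (τ / 4) * Tt 1 τ u := by
  have h := hasSum_int_even_odd (f := fun n : ℤ => jacobiTheta₂_term n u (τ / 2))
    (m := Tt 0 τ u) (m' := eC (τ / 4) * Tt 1 τ u) (by
      convert Tt_hasSum 0 hτ u using 2 with g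
      rw [jacobiTheta₂_term, eC]; congr 1; push_cast; ring) (by
      have h2 := (Tt_hasSum 1 hτ u).mul_left (eC (τ / 4))
      have e : (fun k : ℤ => jacobiTheta₂_term (2 * k + 1) u (τ / 2)) = fun g : ℤ =>
          eC (τ / 4) * eC (((g : ℂ) ^ 2 + (1 : ℤ) * g) * τ + (2 * g + (1 : ℤ)) * u) := by
        ext g
        rw [← eC_add, jacobiTheta₂_term, eC]; congr 1; push_cast; ring
      rw [e]; exact h2)
  exact h.tsum_eq

lemma jac_split' {τ : ℂ} (hτ : UHP τ) (u : ℂ) :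
    jacobiTheta₂ (u + 1 / 2) (τ / 2) = Tt 0 τ u - eC (τ / 4) * Tt 1 τ u := by
  rw [jac_split hτ]
  have h0 : Tt 0 τ (u + 1 / 2) = Tt 0 τ u := by
    unfold Tt; congr 1; ext g
    refine Eq.trans (congrArg eC ?_) (eC_add_int _ g); push_cast; ring
  have h1 : Tt 1 τ (u + 1 / 2) = -Tt 1 τ u := by
    unfold Tt; rw [← tsum_neg]; congr 1; ext g
    rw [neg_eq_neg_one_mul, ← eC_half, ← eC_add]; refine Eq.trans (congrArg eC ?_) (eC_add_int _ g); push_cast; ring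
  rw [h0, h1]; ring

lemma Tt0_S {τ : ℂ} (hτ : UHP τ) (u : ℂ) : Tt 0 τ u =
    1 / (-I * (2 * τ)) ^ (1 / 2 : ℂ) * eC (-(1 / τ) * u ^ 2) *
      (Tt 0 (-1 / τ) (1 / τ * u) + eC ((-1 / τ) / 4) * Tt 1 (-1 / τ) (1 / τ * u)) := by
  have h0 := UHP_ne hτ
  rw [← jac_split (UHP_S hτ), Tt_eq, jacobiTheta₂_functional_equation]
  simp only [Int.cast_zero, zero_mul, eC_zero, one_mul, add_zero]
  have e1 : (2 * u) / (2 * τ) = 1 / τ * u := by field_simp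
  have e2 : -1 / (2 * τ) = -1 / τ / 2 := by field_simp
  have e3 : Complex.exp (-Real.pi * I * (2 * u) ^ 2 / (2 * τ)) = eC (-(1 / τ) * u ^ 2) := by
    simp only [eC]; congr 1; field_simp
  rw [e1, e2, e3]

lemma Tt1_S {τ : ℂ} (hτ : UHP τ) (u : ℂ) : eC (τ / 4) * Tt 1 τ u =
    1 / (-I * (2 * τ)) ^ (1 / 2 : ℂ) * eC (-(1 / τ) * u ^ 2) *
      (Tt 0 (-1 / τ) (1 / τ * u) - eC ((-1 / τ) / 4) * Tt 1 (-1 / τ) (1 / τ * u)) := by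
  have h0 := UHP_ne hτ
  rw [← jac_split' (UHP_S hτ), Tt_eq, jacobiTheta₂_functional_equation]
  have e1 : (2 * u + (1 : ℤ) * τ) / (2 * τ) = 1 / τ * u + 1 / 2 := by push_cast; field_simp
  have e2 : -1 / (2 * τ) = -1 / τ / 2 := by field_simp
  rw [e1, e2]
  have e3 : eC (τ / 4) * (eC ((1 : ℤ) * u) * Complex.exp (-Real.pi * I * (2 * u + (1 : ℤ) * τ) ^ 2 / (2 * τ)))
     = eC (-(1 / τ) * u ^ 2) := by
    simp only [eC, ← Complex.exp_add]; congr 1; push_cast; field_simp; ring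
  rw [← e3]; ring

/-- antisymmetric theta combination -/
def Et (τ u : ℂ) : ℂ := eC (τ / 4) * (Tt 0 τ 0 * Tt 1 τ u - Tt 1 τ 0 * Tt 0 τ u)

lemma Et_S {τ : ℂ} (hτ : UHP τ) (u : ℂ) : Et τ u =
    1 / (I * τ) * eC (-(1 / τ) * u ^ 2) * Et (-1 / τ) (1 / τ * u) := by
  have h0 := UHP_ne hτ
  have a0 := Tt0_S hτ u
  have a1 := Tt1_S hτ u
  have b0 := Tt0_S hτ 0
  have b1 := Tt1_S hτ 0
  have hk : (1 / (-I * (2 * τ)) ^ (1 / 2 : ℂ)) ^ 2 = 1 / (-I * (2 * τ)) := by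
    rw [div_pow, ← Complex.cpow_nat_mul]
    simp
  set κ := 1 / (-I * (2 * τ)) ^ (1 / 2 : ℂ)
  have : Et τ u = Tt 0 τ 0 * (eC (τ / 4) * Tt 1 τ u) - (eC (τ / 4) * Tt 1 τ 0) * Tt 0 τ u := by
    rw [Et]; ring
  rw [this, a0, a1, b0, b1]
  have hI : 1 / (I * τ) = -2 * κ ^ 2 := by
    rw [hk]; field_simp
  rw [hI, Et]
  simp only [mul_zero, ne_eq, OfNat.ofNat_ne_zero, not_false_eq_true, zero_pow, eC_zero]
  ring

lemma Tt_diff (a : ℤ) {τ : ℂ} (hτ : UHP τ) : Differentiable ℂ (Tt a τ) := (Tt_idx a hτ).diff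

lemma c2_Et {τ : ℂ} (hτ : UHP τ) : c2 (Et τ) = eC (τ / 4) * wr τ := by
  have h : Et τ = fun u => (eC (τ / 4) * Tt 0 τ 0) * Tt 1 τ u + (-eC (τ / 4) * Tt 1 τ 0) * Tt 0 τ u := by
    ext u; rw [Et]; ring
  rw [h, c2_add ((Tt_diff 1 hτ).const_mul _) ((Tt_diff 0 hτ).const_mul _), c2_const_mul,
    c2_const_mul, c2_Tt (Or.inl rfl) hτ, c2_Tt (Or.inr rfl) hτ, wr]
  ring

lemma wr_S {τ : ℂ} (hτ : UHP τ) : eC ((-1 / τ) / 4) * wr (-1 / τ) = I * τ ^ 3 * (eC (τ / 4) * wr τ) := by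
  have h0 := UHP_ne hτ
  have hd : Differentiable ℂ (Et (-1 / τ)) := by
    have h1 := Tt_diff 1 (UHP_S hτ)
    have h2 := Tt_diff 0 (UHP_S hτ)
    unfold Et; fun_prop
  have he : Et τ = fun u => 1 / (I * τ) * (eC (-(1 / τ) * u ^ 2) * Et (-1 / τ) (1 / τ * u)) := by
    ext u; rw [Et_S hτ]; ring
  have := c2_Et hτ
  rw [he, c2_const_mul, c2_mul (by fun_prop) (by fun_prop), c2_comp_mul, c2_Et (UHP_S hτ),
    deriv_eC_sq] at this
  have z : Et (-1 / τ) 0 = 0 := by rw [Et]; ring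
  simp only [mul_zero, z, zero_mul, ne_eq, OfNat.ofNat_ne_zero, not_false_eq_true, zero_pow, eC_zero,
    zero_add, one_mul] at this
  rw [← this]; field_simp

open UpperHalfPlane in
lemma wr_ne {τ : ℂ} (hτ : UHP τ) : wr τ ≠ 0 := by
  let F : UpperHalfPlane → ℂ := fun z => eC z * wr z ^ 4
  have hF4 : ∀ z : ℂ, eC z * wr z ^ 4 = (eC (z / 4) * wr z) ^ 4 := by
    intro z
    have : eC z = eC (z / 4) ^ 4 := by
      rw [eC, eC, ← Complex.exp_nat_mul]; congr 1; push_cast; ring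
    rw [this]; ring
  have hS : SlashAction.map (12 : ℤ) ModularGroup.S F = F := by
    ext z
    rw [ModularForm.slash_action_eq'_iff, UpperHalfPlane.modular_S_smul]
    have h := wr_S (τ := z) z.2
    simp only [F, hF4]
    have e : (-(z:ℂ))⁻¹ = -1 / z := by
      rw [neg_div, one_div, inv_neg]
    rw [e, h]
    simp [ModularGroup.S]
    have h4 := Complex.I_pow_four
    have e12 : (z : ℂ) ^ (12 : ℤ) = (z : ℂ) ^ 12 := by norm_cast
    try rw [e12]
    simp only [mul_pow, h4]
    ring
  have hT : SlashAction.map (12 : ℤ) ModularGroup.T F = F := by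
    ext z
    rw [ModularForm.slash_action_eq'_iff, UpperHalfPlane.modular_T_smul]
    simp only [F]
    have e : (((1 : ℝ) +ᵥ z : UpperHalfPlane) : ℂ) = z + 1 := by simp [add_comm]
    rw [e, wr_T]
    have : eC (z + 1) = eC z := by simpa using eC_add_int z 1
    rw [this]
    simp [ModularGroup.T]
  have hbd : Tendsto (fun z => eC z * wr z ^ 4) imInf (𝓝 0) := by
    have h1 : Tendsto eC imInf (𝓝 0) := by
      have := qs_tendsto (ι := Unit) (fun _ => 1) (fun _ => 1) (hasSum_fintype _).summable
      simpa using this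
    simpa using h1.mul (wr_lim.pow 4)
  let f : CuspForm (Matrix.SpecialLinearGroup.mapGL ℝ).range 12 :=
    { toFun := F
      slash_action_eq' := by
        intro A hA
        obtain ⟨A, rfl⟩ := hA
        exact SlashInvariantForm.slash_action_generators_SL2Z hS hT A
      holo' := by
        rw [UpperHalfPlane.mdifferentiable_iff]
        have hd : DifferentiableOn ℂ (fun z => eC z * wr z ^ 4) {z : ℂ | UHP z} := by
          have := wr_diff; fun_prop
        refine hd.congr fun z hz => ?_
        simp [F, UpperHalfPlane.ofComplex_apply_of_im_pos hz]
      zero_at_cusps' := by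
        intro c hc
        rw [Subgroup.IsArithmetic.isCusp_iff_isCusp_SL2Z] at hc
        rw [OnePoint.isZeroAt_iff_forall_SL2Z hc]
        intro γ _
        rw [SlashInvariantForm.slash_action_generators_SL2Z hS hT]
        rw [UpperHalfPlane.isZeroAtImInfty_iff]
        intro ε hε
        have := (Metric.tendsto_nhds.1 hbd) ε hε
        rw [imInf, Filter.eventually_comap] at this
        obtain ⟨A, hA⟩ := Filter.eventually_atTop.1 this
        refine ⟨A, fun z hz => ?_⟩
        have := hA _ hz z rfl
        simpa [F] using this.le }
  obtain ⟨c, hc⟩ := CuspForm.exists_smul_discriminant_of_weight_eq_twelve f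
  have hfz : ∀ z : UpperHalfPlane, c * ModularForm.discriminant z = eC z * wr z ^ 4 := fun z =>
    congrArg (fun g : CuspForm (Matrix.SpecialLinearGroup.mapGL ℝ).range 12 => g z) hc
  have hne : ∀ᶠ z in imInf, wr z ≠ 0 := wr_lim.eventually_ne (by simp [Real.pi_ne_zero])
  obtain ⟨z, hz, hz'⟩ := (hne.and imInf_UHP).exists
  have hc0 : c ≠ 0 := by
    rintro rfl
    have := hfz ⟨z, hz'⟩
    simp [eC_ne_zero, hz] at this
  intro hw
  have := hfz ⟨τ, hτ⟩
  simp [hw, hc0, ModularForm.discriminant_ne_zero] at this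

open Filter Topology

/-- Moebius action -/
def mob (M : Matrix.SpecialLinearGroup (Fin 2) ℤ) (τ : ℂ) : ℂ := (Ma M * τ + Mb M) / (Mc M * τ + Md M)
/-- automorphy factor -/
def jf (M : Matrix.SpecialLinearGroup (Fin 2) ℤ) (τ : ℂ) : ℂ := Mc M * τ + Md M

lemma M_det (M : Matrix.SpecialLinearGroup (Fin 2) ℤ) : Ma M * Md M - Mb M * Mc M = 1 := by
  have h := M.2
  rw [Matrix.det_fin_two] at h
  simp only [Ma, Mb, Mc, Md]
  exact_mod_cast congrArg (Int.cast (R := ℂ)) h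

lemma jf_ne (M : Matrix.SpecialLinearGroup (Fin 2) ℤ) {τ : ℂ} (hτ : UHP τ) : jf M τ ≠ 0 := by
  intro h
  have hτ' : 0 < τ.im := hτ
  have hi := congrArg Complex.im h
  simp [jf, Mc, Md] at hi
  have hc : M.1 1 0 = 0 := by
    rcases hi with h | h
    · exact h
    · exact absurd h hτ'.ne'
  have hd : M.1 1 1 = 0 := by
    have := h; simp [jf, Mc, Md, hc] at this; exact this
  have := M.2
  rw [Matrix.det_fin_two, hc, hd] at this
  simp at this

lemma UHP_mob (M : Matrix.SpecialLinearGroup (Fin 2) ℤ) {τ : ℂ} (hτ : UHP τ) : UHP (mob M τ) := by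
  have hj := jf_ne M hτ
  have hτ' : 0 < τ.im := hτ
  have hd := M.2
  rw [Matrix.det_fin_two] at hd
  have hd' : ((M.1 0 0 : ℤ) : ℝ) * (M.1 1 1 : ℤ) - (M.1 0 1 : ℤ) * (M.1 1 0 : ℤ) = 1 := by exact_mod_cast hd
  have key : (mob M τ).im = τ.im / Complex.normSq (jf M τ) := by
    rw [mob, Complex.div_im]
    change _ / Complex.normSq (jf M τ) - _ / Complex.normSq (jf M τ) = _
    rw [← sub_div]; congr 1
    simp [Ma, Mb, Mc, Md]
    linear_combination τ.im * hd'
  rw [UHP, key]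
  exact div_pos hτ' (Complex.normSq_pos.mpr hj)

lemma Idx.zshift {τ : ℂ} {F : ℂ → ℂ} (h : Idx τ F) (m : ℤ) : ∀ u, F (u + m) = F u := by
  induction m using Int.induction_on with
  | zero => simp
  | succ i ih =>
    intro u
    rw [show u + ((i + 1 : ℤ) : ℂ) = (u + (i : ℤ)) + 1 by push_cast; ring, h.per, ih]
  | pred i ih =>
    intro u
    rw [← h.per, ← ih u]; congr 1; push_cast; ring

lemma Idx.tshift {τ : ℂ} {F : ℂ → ℂ} (h : Idx τ F) (l : ℤ) :
    ∀ u, F (u + l * τ) = eC (-(l : ℂ) ^ 2 * τ - 2 * l * u) * F u := by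
  induction l using Int.induction_on with
  | zero => simp [eC_zero]
  | succ i ih =>
    intro u
    rw [show u + ((i + 1 : ℤ) : ℂ) * τ = (u + (i : ℤ) * τ) + τ by push_cast; ring, h.qper, ih,
      ← mul_assoc, ← eC_add]
    congr 2; push_cast; ring
  | pred i ih =>
    intro u
    have h1 := h.qper (u + ((-i - 1 : ℤ) : ℂ) * τ)
    rw [show u + ((-i - 1 : ℤ) : ℂ) * τ + τ = u + ((-i : ℤ) : ℂ) * τ by push_cast; ring, ih] at h1
    have h2 : F (u + ((-i - 1 : ℤ) : ℂ) * τ) =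
      eC (-(-τ - 2 * (u + ((-i - 1 : ℤ) : ℂ) * τ))) * (eC (-τ - 2 * (u + ((-i - 1 : ℤ) : ℂ) * τ)) *
        F (u + ((-i - 1 : ℤ) : ℂ) * τ)) := by
      rw [← mul_assoc, ← eC_add, neg_add_cancel, eC_zero, one_mul]
    rw [h2, ← h1, ← mul_assoc, ← eC_add]
    congr 2; push_cast; ring

lemma Idx.shift {τ : ℂ} {F : ℂ → ℂ} (h : Idx τ F) (l m : ℤ) (u : ℂ) :
    F (u + l * τ + m) = eC (-(l : ℂ) ^ 2 * τ - 2 * l * u) * F u := by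
  rw [h.zshift, h.tshift]

lemma Idx.transf (M : Matrix.SpecialLinearGroup (Fin 2) ℤ) {τ : ℂ} (hτ : UHP τ) {F : ℂ → ℂ}
    (h : Idx (mob M τ) F) : Idx τ (fun u => eC (-(Mc M / jf M τ) * u ^ 2) * F (1 / jf M τ * u)) := by
  have hj := jf_ne M hτ
  have hdet := M_det M
  have hm : mob M τ * jf M τ = Ma M * τ + Mb M := by rw [mob]; exact div_mul_cancel₀ _ hj
  have hjd : jf M τ = Mc M * τ + Md M := rfl
  have hi : (1 / jf M τ) * jf M τ = 1 := by field_simp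
  rw [show Mc M / jf M τ = Mc M * (1 / jf M τ) by ring]
  set i := 1 / jf M τ
  set t := mob M τ
  have e1 : i * 1 = -Mc M * t + Ma M := by
    apply mul_right_cancel₀ hj
    linear_combination hi + Mc M * hm - Ma M * hjd - hdet
  have e2 : i * τ = Md M * t - Mb M := by
    apply mul_right_cancel₀ hj
    linear_combination τ * hi - Md M * hm + Mb M * hjd - τ * hdet
  refine ⟨?_, fun u => ?_, fun u => ?_⟩
  · have := h.diff; fun_prop
  · have h1 := h.shift (-M.1 1 0) (M.1 0 0) (i * u)
    have e : i * (u + 1) = i * u + ((-M.1 1 0 : ℤ) : ℂ) * t + ((M.1 0 0 : ℤ) : ℂ) := by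
      push_cast; simp only [Mc, Ma] at e1; linear_combination e1
    rw [e, h1, ← mul_assoc, ← eC_add]
    congr 1
    refine Eq.trans (congrArg eC ?_) (eC_add_int _ (-(M.1 1 0) * (M.1 0 0)))
    push_cast; simp only [Mc, Ma] at e1 ⊢
    linear_combination (-((M.1 1 0 : ℤ) : ℂ)) * e1
  · have h1 := h.shift (M.1 1 1) (-M.1 0 1) (i * u)
    have e : i * (u + τ) = i * u + ((M.1 1 1 : ℤ) : ℂ) * t + ((-M.1 0 1 : ℤ) : ℂ) := by
      push_cast; simp only [Md, Mb] at e2; linear_combination e2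
    rw [e, h1, ← mul_assoc, ← mul_assoc (eC (-τ - 2 * u)), ← eC_add, ← eC_add]
    congr 1
    refine Eq.trans (congrArg eC ?_) (eC_add_int _ (-(M.1 0 1) * (M.1 1 1)))
    push_cast; simp only [Mc, Ma, Md, Mb] at *
    linear_combination (-2 * u) * hi + 2 * u * i * hjd - ((M.1 1 0 : ℤ) : ℂ) * τ * e2
      + ((M.1 1 1 : ℤ) : ℂ) * (t * hjd - hm) - τ * hdet

/-- odd basis function -/
def At (τ u : ℂ) : ℂ := (wr τ)⁻¹ * (Tt 0 τ 0 * Tt 1 τ u + (-Tt 1 τ 0) * Tt 0 τ u)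
/-- even basis function -/
def Bt (τ u : ℂ) : ℂ := (wr τ)⁻¹ * (tc 1 τ * Tt 0 τ u + (-tc 0 τ) * Tt 1 τ u)

lemma At_idx {τ : ℂ} (hτ : UHP τ) : Idx τ (At τ) :=
  Idx.smul _ (((Tt_idx 1 hτ).smul _).add ((Tt_idx 0 hτ).smul _))
lemma Bt_idx {τ : ℂ} (hτ : UHP τ) : Idx τ (Bt τ) :=
  Idx.smul _ (((Tt_idx 0 hτ).smul _).add ((Tt_idx 1 hτ).smul _))
lemma At_zero (τ : ℂ) : At τ 0 = 0 := by rw [At]; ring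
lemma Bt_zero {τ : ℂ} (hτ : UHP τ) : Bt τ 0 = 1 := by
  have h : tc 1 τ * Tt 0 τ 0 + (-tc 0 τ) * Tt 1 τ 0 = wr τ := by rw [wr]; ring
  rw [Bt, h, inv_mul_cancel₀ (wr_ne hτ)]
lemma c2_At {τ : ℂ} (hτ : UHP τ) : c2 (At τ) = 1 := by
  have h0 := Tt_diff 0 hτ
  have h1 := Tt_diff 1 hτ
  have h : Tt 0 τ 0 * tc 1 τ + (-Tt 1 τ 0) * tc 0 τ = wr τ := by rw [wr]; ring
  unfold At
  rw [c2_const_mul, c2_add (by fun_prop) (by fun_prop), c2_const_mul, c2_const_mul,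
    c2_Tt (Or.inl rfl) hτ, c2_Tt (Or.inr rfl) hτ, h, inv_mul_cancel₀ (wr_ne hτ)]
lemma c2_Bt {τ : ℂ} (hτ : UHP τ) : c2 (Bt τ) = 0 := by
  have h0 := Tt_diff 0 hτ
  have h1 := Tt_diff 1 hτ
  unfold Bt
  rw [c2_const_mul, c2_add (by fun_prop) (by fun_prop), c2_const_mul, c2_const_mul,
    c2_Tt (Or.inl rfl) hτ, c2_Tt (Or.inr rfl) hτ]
  ring
lemma At_even (τ u : ℂ) : At τ (-u) = At τ u := by simp only [At, Tt_even]
lemma Bt_even (τ u : ℂ) : Bt τ (-u) = Bt τ u := by simp only [Bt, Tt_even]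

lemma fst_diffAt {f : ℂ → ℂ} (hf : DifferentiableOn ℂ f {τ | UHP τ}) {p : ℂ × ℂ} (hp : UHP p.1) :
    DifferentiableAt ℂ (fun p : ℂ × ℂ => f p.1) p :=
  (hf.differentiableAt (isOpen_UHP.mem_nhds hp)).comp p differentiableAt_fst

lemma At_holo {p : ℂ × ℂ} (hp : UHP p.1) : DifferentiableAt ℂ (fun p : ℂ × ℂ => At p.1 p.2) p := by
  have h0 := Tt_holo 0 hp
  have h1 := Tt_holo 1 hp
  have h2 := fst_diffAt (Tt0_diff 0 0) hp
  have h3 := fst_diffAt (Tt0_diff 1 0) hp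
  have h4 := fst_diffAt wr_diff hp
  have := wr_ne hp
  unfold At; fun_prop (disch := assumption)
lemma Bt_holo {p : ℂ × ℂ} (hp : UHP p.1) : DifferentiableAt ℂ (fun p : ℂ × ℂ => Bt p.1 p.2) p := by
  have h0 := Tt_holo 0 hp
  have h1 := Tt_holo 1 hp
  have h2 := fst_diffAt (tc_diff (Or.inl rfl)) hp
  have h3 := fst_diffAt (tc_diff (Or.inr rfl)) hp
  have h4 := fst_diffAt wr_diff hp
  have := wr_ne hp
  unfold Bt; fun_prop (disch := assumption)

lemma tpi_ne : (2 * Real.pi * I : ℂ) ^ 2 ≠ 0 := by simp [Real.pi_ne_zero]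

lemma At_lim : Tendsto (fun τ => At τ (1 / 2)) imInf (𝓝 (((2 * Real.pi * I : ℂ) ^ 2)⁻¹ * (-4))) := by
  simp only [At, Tt_half0, Tt_half1]
  have := (wr_lim.inv₀ tpi_ne).mul ((Tt0_lim0.mul Tt0_lim1.neg).add (Tt0_lim1.neg.mul Tt0_lim0))
  convert this using 2; ring

lemma Bt_lim : Tendsto (fun τ => Bt τ (1 / 2)) imInf (𝓝 1) := by
  simp only [Bt, Tt_half0, Tt_half1]
  have := (wr_lim.inv₀ tpi_ne).mul ((tc_lim1.mul Tt0_lim0).add (tc_lim0.neg.mul Tt0_lim1.neg))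
  convert this using 2
  field_simp [tpi_ne]; simp

lemma span {τ : ℂ} (hτ : UHP τ) {F : ℂ → ℂ} (h : Idx τ F) (u : ℂ) :
    F u = F 0 * Bt τ u + c2 F * At τ u :=
  Idx.span h (At_idx hτ) (Bt_idx hτ) (At_zero τ) (c2_At hτ) (Bt_zero hτ) (c2_Bt hτ) u

lemma At_transf (M : Matrix.SpecialLinearGroup (Fin 2) ℤ) {τ : ℂ} (hτ : UHP τ) (u : ℂ) :
    At (mob M τ) (u / jf M τ) = (jf M τ ^ 2)⁻¹ * eC (Mc M / jf M τ * u ^ 2) * At τ u := by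
  have hi := At_idx (UHP_mob M hτ)
  have hd := hi.diff
  have h := span hτ (hi.transf M hτ) u
  rw [c2_mul (by fun_prop) (by fun_prop), c2_comp_mul, c2_At (UHP_mob M hτ), deriv_eC_sq] at h
  simp only [mul_zero, At_zero, zero_mul, ne_eq, OfNat.ofNat_ne_zero, not_false_eq_true, zero_pow,
    eC_zero, zero_add, one_mul, mul_one] at h
  rw [neg_mul, eC_neg] at h
  have hne := eC_ne_zero (Mc M / jf M τ * u ^ 2)
  rw [inv_mul_eq_iff_eq_mul₀ hne] at h
  rw [div_eq_mul_one_div, mul_comm u, h]; simp; ring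

lemma Bt_transf (M : Matrix.SpecialLinearGroup (Fin 2) ℤ) {τ : ℂ} (hτ : UHP τ) (u : ℂ) :
    Bt (mob M τ) (u / jf M τ) = eC (Mc M / jf M τ * u ^ 2) *
      (Bt τ u - 2 * Real.pi * I * (Mc M / jf M τ) * At τ u) := by
  have hi := Bt_idx (UHP_mob M hτ)
  have hd := hi.diff
  have h := span hτ (hi.transf M hτ) u
  rw [c2_mul (by fun_prop) (by fun_prop), c2_comp_mul, c2_Bt (UHP_mob M hτ), deriv_eC_sq, c2_eC_sq] at h
  simp only [mul_zero, Bt_zero (UHP_mob M hτ), zero_mul, ne_eq, OfNat.ofNat_ne_zero, not_false_eq_true, zero_pow,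
    eC_zero, zero_add, one_mul, mul_one, add_zero] at h
  rw [neg_mul, eC_neg] at h
  have hne := eC_ne_zero (Mc M / jf M τ * u ^ 2)
  rw [inv_mul_eq_iff_eq_mul₀ hne] at h
  rw [div_eq_mul_one_div, mul_comm u, h]; ring

open Filter Topology

lemma qexp {H : ℂ → ℂ} {h0 : ℂ} (hd : DifferentiableOn ℂ H {τ | UHP τ})
    (hp : ∀ τ, UHP τ → H (τ + 1) = H τ) (hl : Tendsto H imInf (𝓝 h0)) :
    ∃ c : ℕ → ℂ, c 0 = h0 ∧ ∀ τ, UHP τ → HasSum (fun n : ℕ => c n * eC (n * τ)) (H τ) := by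
  let f : UpperHalfPlane → ℂ := fun z => H z
  have hof : ∀ z, UHP z → (f ∘ UpperHalfPlane.ofComplex) z = H z := fun z hz => by
    simp [f, UpperHalfPlane.ofComplex_apply_of_im_pos hz]
  have hper : Function.Periodic (f ∘ UpperHalfPlane.ofComplex) ((1 : ℝ) : ℂ) := by
    intro z
    by_cases hz : UHP z
    · have hz1 : UHP (z + ((1 : ℝ) : ℂ)) := by simpa [UHP] using hz
      rw [hof _ hz, hof _ hz1]
      simpa using hp z hz
    · have h1 : z.im ≤ 0 := not_lt.1 hz
      have h2 : (z + ((1 : ℝ) : ℂ)).im ≤ 0 := by simpa using h1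
      simp only [Function.comp]
      rw [UpperHalfPlane.ofComplex_apply_of_im_nonpos h1, UpperHalfPlane.ofComplex_apply_of_im_nonpos h2]
  have hmd : MDifferentiable (modelWithCornersSelf ℂ ℂ) (modelWithCornersSelf ℂ ℂ) f := by
    rw [UpperHalfPlane.mdifferentiable_iff]
    exact hd.congr fun z hz => hof z hz
  have hb : UpperHalfPlane.IsBoundedAtImInfty f := by
    rw [UpperHalfPlane.isBoundedAtImInfty_iff]
    have := (Metric.tendsto_nhds.1 hl) 1 one_pos
    rw [imInf, Filter.eventually_comap] at this
    obtain ⟨A, hA⟩ := Filter.eventually_atTop.1 this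
    refine ⟨‖h0‖ + 1, A, fun z hz => ?_⟩
    have h1 := hA _ hz z rfl
    rw [dist_eq_norm] at h1
    have := norm_add_le h0 (H z - h0)
    simp at this
    simp [f]; linarith
  have hq := UpperHalfPlane.hasSum_qExpansion one_pos hper hmd hb
  let c : ℕ → ℂ := fun n => PowerSeries.coeff n (UpperHalfPlane.qExpansion 1 f)
  have hc : ∀ τ, UHP τ → HasSum (fun n : ℕ => c n * eC (n * τ)) (H τ) := by
    intro τ hτ
    have := hq ⟨τ, hτ⟩
    convert this using 2 with n
    simp only [c, smul_eq_mul, Function.Periodic.qParam]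
    rw [← Complex.exp_nat_mul, eC]; congr 2
    simp; ring
  refine ⟨c, ?_, hc⟩
  have h1 := qs_tendsto c (fun n => n) ((hc I (by simp [UHP])).summable.norm)
  have h2 : (∑' i : ℕ, if i = 0 then c i else 0) = c 0 := tsum_ite_eq 0 c
  rw [h2] at h1
  have h3 : H =ᶠ[imInf] fun τ => ∑' i : ℕ, c i * eC (i * τ) := by
    filter_upwards [imInf_UHP] with τ hτ using (hc τ hτ).tsum_eq.symm
  exact tendsto_nhds_unique h1 (hl.congr' h3)

lemma hasSum_mul_prod {α β : Type} {f : α → ℂ} {g : β → ℂ} {s t : ℂ} (hf : HasSum f s) (hg : HasSum g t) :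
    HasSum (fun x : α × β => f x.1 * g x.2) (s * t) := by
  have h1 : Summable fun x : α × β => f x.1 * g x.2 :=
    summable_mul_of_summable_norm (f := f) (g := g) hf.summable.norm hg.summable.norm
  exact HasSum.mul hf hg h1

lemma four_ab {a b : ℤ} (ha : a = 0 ∨ a = 1) (hb : b = 0 ∨ b = 1) {H : ℂ → ℂ} {h0 : ℂ}
    (hd : DifferentiableOn ℂ H {τ | UHP τ})
    (hp : ∀ τ, UHP τ → H (τ + 1) = H τ) (hl : Tendsto H imInf (𝓝 h0))
    (hz : 0 < a ^ 2 + b ^ 2 → h0 = 0) :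
    ∃ C : ℕ × ℤ × ℤ → ℂ, (∀ P : ℕ × ℤ × ℤ, 4 * (P.1 : ℤ) < P.2.1 ^ 2 + P.2.2 ^ 2 → C P = 0) ∧
      ∀ τ u v, UHP τ → HasSum (fun P : ℕ × ℤ × ℤ => C P * eC (P.1 * τ + P.2.1 * u + P.2.2 * v))
        (H τ * (Tt a τ u * Tt b τ v)) := by
  obtain ⟨c, hc0, hc⟩ := qexp hd hp hl
  let ι : ℕ × ℤ × ℤ → ℕ × ℤ × ℤ := fun x => (x.1 + ex a x.2.1 + ex b x.2.2, 2 * x.2.1 + a, 2 * x.2.2 + b)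
  have hι : Function.Injective ι := by
    rintro ⟨n, g, h⟩ ⟨n', g', h'⟩ he
    simp only [ι, Prod.mk.injEq] at he
    obtain ⟨e1, e2, e3⟩ := he
    have e2' : g = g' := by omega
    have e3' : h = h' := by omega
    subst e2' e3'
    simp at e1
    simp [e1]
  refine ⟨Function.extend ι (fun x => c x.1) 0, ?_, ?_⟩
  · rintro P hP
    by_cases hr : ∃ x, ι x = P
    · obtain ⟨⟨n, g, h⟩, rfl⟩ := hr
      rw [hι.extend_apply]
      simp only [ι] at hP ⊢
      push_cast at hP
      rw [ex_cast ha, ex_cast hb] at hP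
      have h1 : 4 * (n : ℤ) < a ^ 2 + b ^ 2 := by nlinarith
      have h2 : n = 0 := by
        rcases ha with rfl | rfl <;> rcases hb with rfl | rfl <;> norm_num at h1 <;> omega
      subst h2
      rw [hc0]; exact hz (by simpa using h1)
    · rw [Function.extend_apply' _ _ _ hr]; rfl
  · intro τ u v hτ
    have s1 := hc τ hτ
    have s2 := Tt_hasSum a hτ u
    have s3 := Tt_hasSum b hτ v
    have s23 := hasSum_mul_prod s2 s3
    have s := hasSum_mul_prod s1 s23
    rw [← hι.hasSum_iff]
    · convert s using 1
      ext ⟨n, g, h⟩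
      simp only [Function.comp, hι.extend_apply]
      rw [mul_assoc]; congr 1
      rw [← eC_add, ← eC_add]; congr 1
      simp only [ι]; push_cast
      rw [ex_castC ha, ex_castC hb]; ring
    · intro P hP
      rw [Function.extend_apply' _ _ _ (by simpa using hP)]
      simp

/-- quadratic combination of basis functions -/
def Ph (p q r : ℂ → ℂ) (τ u v : ℂ) : ℂ :=
  p τ * (Bt τ u * Bt τ v) + q τ * (At τ u * Bt τ v + Bt τ u * At τ v) + r τ * (At τ u * At τ v)

/-- data for building a form -/
structure Trip (k : ℕ) (p q r : ℂ → ℂ) (p0 : ℂ) : Prop where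
  hp : DifferentiableOn ℂ p {τ | UHP τ}
  hq : DifferentiableOn ℂ q {τ | UHP τ}
  hr : DifferentiableOn ℂ r {τ | UHP τ}
  tp : ∀ M τ, UHP τ → p (mob M τ) = jf M τ ^ k * p τ
  tq : ∀ M τ, UHP τ → q (mob M τ) = jf M τ ^ (k + 2) * (q τ + (2 * Real.pi * I * (Mc M / jf M τ)) * p τ)
  tr : ∀ M τ, UHP τ → r (mob M τ) = jf M τ ^ (k + 4) * (r τ + 2 * (2 * Real.pi * I * (Mc M / jf M τ)) * q τ
    + (2 * Real.pi * I * (Mc M / jf M τ)) ^ 2 * p τ)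
  lp : Tendsto p imInf (𝓝 p0)
  lq : Tendsto q imInf (𝓝 0)
  lr : Tendsto r imInf (𝓝 0)

lemma mob_T (τ : ℂ) : mob ModularGroup.T τ = τ + 1 ∧ jf ModularGroup.T τ = 1 ∧ Mc ModularGroup.T = 0 := by
  simp [mob, jf, Ma, Mb, Mc, Md, ModularGroup.T]

section
variable {k : ℕ} {p q r : ℂ → ℂ} {p0 : ℂ}

lemma Trip.pT (h : Trip k p q r p0) {τ : ℂ} (hτ : UHP τ) : p (τ + 1) = p τ := by
  have := h.tp ModularGroup.T τ hτ
  obtain ⟨e1, e2, e3⟩ := mob_T τ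
  simpa [e1, e2, e3] using this
lemma Trip.qT (h : Trip k p q r p0) {τ : ℂ} (hτ : UHP τ) : q (τ + 1) = q τ := by
  have := h.tq ModularGroup.T τ hτ
  obtain ⟨e1, e2, e3⟩ := mob_T τ
  simpa [e1, e2, e3] using this
lemma Trip.rT (h : Trip k p q r p0) {τ : ℂ} (hτ : UHP τ) : r (τ + 1) = r τ := by
  have := h.tr ModularGroup.T τ hτ
  obtain ⟨e1, e2, e3⟩ := mob_T τ
  simpa [e1, e2, e3] using this

lemma Ph_symm (τ u v : ℂ) : Ph p q r τ u v = Ph p q r τ v u := by unfold Ph; ring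
lemma Ph_even (τ u v : ℂ) : Ph p q r τ (-u) v = Ph p q r τ u v := by
  simp only [Ph, At_even, Bt_even]

lemma Ph_transf (h : Trip k p q r p0) (M : Matrix.SpecialLinearGroup (Fin 2) ℤ) {τ : ℂ} (hτ : UHP τ) (u v : ℂ) :
    Ph p q r (mob M τ) (u / jf M τ) (v / jf M τ) =
      jf M τ ^ k * eC (Mc M / jf M τ * (u ^ 2 + v ^ 2)) * Ph p q r τ u v := by
  have hj := jf_ne M hτ
  simp only [Ph, At_transf M hτ, Bt_transf M hτ, h.tp M τ hτ, h.tq M τ hτ, h.tr M τ hτ]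
  rw [mul_add (Mc M / jf M τ) (u ^ 2) (v ^ 2), eC_add]
  set x := eC (Mc M / jf M τ * u ^ 2)
  set y := eC (Mc M / jf M τ * v ^ 2)
  generalize (2 * Real.pi * I * (Mc M / jf M τ)) = s
  field_simp
  ring

lemma Ph_idx {τ : ℂ} (hτ : UHP τ) (v : ℂ) : Idx τ (fun u => Ph p q r τ u v) := by
  have h := ((Bt_idx hτ).smul (p τ * Bt τ v + q τ * At τ v)).add
    ((At_idx hτ).smul (q τ * Bt τ v + r τ * At τ v))
  convert h using 2 with u
  unfold Ph; ring

lemma Ph_holo (h : Trip k p q r p0) : DifferentiableOn ℂ (fun x : ℂ × ℂ × ℂ =>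
    Ph p q r x.1 ((x.2.1 + x.2.2) / 2) (I * (x.2.1 - x.2.2) / 2)) {x | UHP x.1} := by
  intro x hx
  apply DifferentiableAt.differentiableWithinAt
  have g1 : DifferentiableAt ℂ (fun x : ℂ × ℂ × ℂ => (x.1, (x.2.1 + x.2.2) / 2)) x := by fun_prop
  have g2 : DifferentiableAt ℂ (fun x : ℂ × ℂ × ℂ => (x.1, I * (x.2.1 - x.2.2) / 2)) x := by fun_prop
  have a1 := DifferentiableAt.comp x (At_holo (p := (x.1, (x.2.1 + x.2.2) / 2)) hx) g1
  have a2 := DifferentiableAt.comp x (At_holo (p := (x.1, I * (x.2.1 - x.2.2) / 2)) hx) g2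
  have b1 := DifferentiableAt.comp x (Bt_holo (p := (x.1, (x.2.1 + x.2.2) / 2)) hx) g1
  have b2 := DifferentiableAt.comp x (Bt_holo (p := (x.1, I * (x.2.1 - x.2.2) / 2)) hx) g2
  have hf : ∀ f : ℂ → ℂ, DifferentiableOn ℂ f {τ | UHP τ} → DifferentiableAt ℂ (fun x : ℂ × ℂ × ℂ => f x.1) x :=
    fun f hf => (hf.differentiableAt (isOpen_UHP.mem_nhds hx)).comp x differentiableAt_fst
  have p1 := hf p h.hp
  have q1 := hf q h.hq
  have r1 := hf r h.hr
  simp only [Function.comp_def] at a1 a2 b1 b2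
  unfold Ph
  exact ((p1.mul (b1.mul b2)).add (q1.mul ((a1.mul b2).add (b1.mul a2)))).add (r1.mul (a1.mul a2))

lemma Ph_fourier (h : Trip k p q r p0) :
    ∃ C : ℕ × ℤ × ℤ → ℂ, (∀ P : ℕ × ℤ × ℤ, 4 * (P.1 : ℤ) < P.2.1 ^ 2 + P.2.2 ^ 2 → C P = 0) ∧
      ∀ τ u v, UHP τ → HasSum (fun P : ℕ × ℤ × ℤ => C P * eC (P.1 * τ + P.2.1 * u + P.2.2 * v))
        (Ph p q r τ u v) := by
  let α0 : ℂ → ℂ := fun τ => (wr τ)⁻¹ * (-Tt 1 τ 0)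
  let α1 : ℂ → ℂ := fun τ => (wr τ)⁻¹ * Tt 0 τ 0
  let β0 : ℂ → ℂ := fun τ => (wr τ)⁻¹ * tc 1 τ
  let β1 : ℂ → ℂ := fun τ => (wr τ)⁻¹ * (-tc 0 τ)
  have hwi : DifferentiableOn ℂ (fun τ => (wr τ)⁻¹) {τ | UHP τ} := wr_diff.inv fun τ hτ => wr_ne hτ
  have dα0 : DifferentiableOn ℂ α0 {τ | UHP τ} := hwi.mul (Tt0_diff 1 0).neg
  have dα1 : DifferentiableOn ℂ α1 {τ | UHP τ} := hwi.mul (Tt0_diff 0 0)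
  have dβ0 : DifferentiableOn ℂ β0 {τ | UHP τ} := hwi.mul (tc_diff (Or.inr rfl))
  have dβ1 : DifferentiableOn ℂ β1 {τ | UHP τ} := hwi.mul (tc_diff (Or.inl rfl)).neg
  have hwl := wr_lim.inv₀ tpi_ne
  have lα0 := hwl.mul Tt0_lim1.neg
  have lα1 := hwl.mul Tt0_lim0
  have lβ0 := hwl.mul tc_lim1
  have lβ1 := hwl.mul tc_lim0.neg
  rw [inv_mul_cancel₀ tpi_ne] at lβ0
  rw [neg_zero, mul_zero] at lβ1
  change Tendsto α0 _ _ at lα0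
  change Tendsto α1 _ _ at lα1
  change Tendsto β0 _ _ at lβ0
  change Tendsto β1 _ _ at lβ1
  have pα0 : ∀ τ, α0 (τ + 1) = α0 τ := fun τ => by simp only [α0, wr_T, Tt_T]
  have pα1 : ∀ τ, α1 (τ + 1) = α1 τ := fun τ => by simp only [α1, wr_T, Tt_T]
  have pβ0 : ∀ τ, β0 (τ + 1) = β0 τ := fun τ => by simp only [β0, wr_T, tc_T]
  have pβ1 : ∀ τ, β1 (τ + 1) = β1 τ := fun τ => by simp only [β1, wr_T, tc_T]
  have hA : ∀ τ u, At τ u = α0 τ * Tt 0 τ u + α1 τ * Tt 1 τ u := fun τ u => by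
    simp only [At, α0, α1]; ring
  have hB : ∀ τ u, Bt τ u = β0 τ * Tt 0 τ u + β1 τ * Tt 1 τ u := fun τ u => by
    simp only [Bt, β0, β1]; ring
  have hp := h.hp
  have hq := h.hq
  have hr := h.hr
  obtain ⟨C0, s0, f0⟩ := four_ab (a := 0) (b := 0) (Or.inl rfl) (Or.inl rfl)
    (H := fun τ => p τ * (β0 τ * β0 τ) + q τ * (α0 τ * β0 τ + β0 τ * α0 τ) + r τ * (α0 τ * α0 τ))
    (by fun_prop) (fun τ hτ => by simp only [h.pT hτ, h.qT hτ, h.rT hτ, pα0, pβ0])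
    (((h.lp.mul (lβ0.mul lβ0)).add (h.lq.mul ((lα0.mul lβ0).add (lβ0.mul lα0)))).add
      (h.lr.mul (lα0.mul lα0))) (by simp)
  obtain ⟨C1, s1, f1⟩ := four_ab (a := 0) (b := 1) (Or.inl rfl) (Or.inr rfl)
    (H := fun τ => p τ * (β0 τ * β1 τ) + q τ * (α0 τ * β1 τ + β0 τ * α1 τ) + r τ * (α0 τ * α1 τ))
    (by fun_prop) (fun τ hτ => by simp only [h.pT hτ, h.qT hτ, h.rT hτ, pα0, pβ0, pα1, pβ1])
    (((h.lp.mul (lβ0.mul lβ1)).add (h.lq.mul ((lα0.mul lβ1).add (lβ0.mul lα1)))).add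
      (h.lr.mul (lα0.mul lα1))) (by simp)
  obtain ⟨C2, s2, f2⟩ := four_ab (a := 1) (b := 0) (Or.inr rfl) (Or.inl rfl)
    (H := fun τ => p τ * (β1 τ * β0 τ) + q τ * (α1 τ * β0 τ + β1 τ * α0 τ) + r τ * (α1 τ * α0 τ))
    (by fun_prop) (fun τ hτ => by simp only [h.pT hτ, h.qT hτ, h.rT hτ, pα0, pβ0, pα1, pβ1])
    (((h.lp.mul (lβ1.mul lβ0)).add (h.lq.mul ((lα1.mul lβ0).add (lβ1.mul lα0)))).add
      (h.lr.mul (lα1.mul lα0))) (by simp)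
  obtain ⟨C3, s3, f3⟩ := four_ab (a := 1) (b := 1) (Or.inr rfl) (Or.inr rfl)
    (H := fun τ => p τ * (β1 τ * β1 τ) + q τ * (α1 τ * β1 τ + β1 τ * α1 τ) + r τ * (α1 τ * α1 τ))
    (by fun_prop) (fun τ hτ => by simp only [h.pT hτ, h.qT hτ, h.rT hτ, pα1, pβ1])
    (((h.lp.mul (lβ1.mul lβ1)).add (h.lq.mul ((lα1.mul lβ1).add (lβ1.mul lα1)))).add
      (h.lr.mul (lα1.mul lα1))) (by simp)
  refine ⟨fun P => C0 P + C1 P + C2 P + C3 P, fun P hP => ?_, fun τ u v hτ => ?_⟩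
  · simp only [s0 P hP, s1 P hP, s2 P hP, s3 P hP, add_zero]
  · have := (((f0 τ u v hτ).add (f1 τ u v hτ)).add (f2 τ u v hτ)).add (f3 τ u v hτ)
    have e1 : (fun P : ℕ × ℤ × ℤ => (C0 P + C1 P + C2 P + C3 P) * eC (P.1 * τ + P.2.1 * u + P.2.2 * v)) =
      fun P : ℕ × ℤ × ℤ => C0 P * eC (P.1 * τ + P.2.1 * u + P.2.2 * v) + C1 P * eC (P.1 * τ + P.2.1 * u + P.2.2 * v)
       + C2 P * eC (P.1 * τ + P.2.1 * u + P.2.2 * v) + C3 P * eC (P.1 * τ + P.2.1 * u + P.2.2 * v) := by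
      ext P; ring
    rw [e1]
    convert this using 1
    simp only [Ph, hA, hB]; ring

end

open Filter Topology

lemma unit_pow {k : ℕ} (hk4 : k % 4 = 0) {ε : ℂ} (h : ε ∈ ({1, -1, Complex.I, -Complex.I} : Set ℂ)) : ε ^ k = 1 := by
  obtain ⟨j, rfl⟩ : ∃ j, k = 4 * j := ⟨k / 4, by omega⟩
  rw [pow_mul]
  have : ε ^ 4 = 1 := by
    simp only [Set.mem_insert_iff, Set.mem_singleton_iff] at h
    rcases h with rfl | rfl | rfl | rfl
    · norm_num
    · norm_num
    · exact I_pow_four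
    · rw [Even.neg_pow (by decide)]; exact I_pow_four
  rw [this, one_pow]

section
variable {k : ℕ} {p q r : ℂ → ℂ} {p0 : ℂ}

lemma Ph_unit {ε : ℂ} (h : ε ∈ ({1, -1, Complex.I, -Complex.I} : Set ℂ)) (σ j z1 z2 : ℂ) :
    Ph p q r σ ((ε * z1 / j + (starRingEnd ℂ) ε * z2 / j) / 2) (I * (ε * z1 / j - (starRingEnd ℂ) ε * z2 / j) / 2)
    = Ph p q r σ ((z1 + z2) / 2 / j) (I * (z1 - z2) / 2 / j) := by
  have hI : I * I = -1 := I_mul_I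
  have hev : ∀ a b, Ph p q r σ a (-b) = Ph p q r σ a b := fun a b => by
    rw [Ph_symm, Ph_even, Ph_symm]
  simp only [Set.mem_insert_iff, Set.mem_singleton_iff] at h
  rcases h with rfl | rfl | rfl | rfl
  · simp only [map_one]; congr 1 <;> ring
  · simp only [map_one, map_neg]
    rw [← Ph_even, ← hev]; congr 1 <;> ring
  · rw [conj_I, Ph_symm, ← Ph_even]; congr 1
    · linear_combination (-(z1 + z2) / 2 / j) * hI
    · ring
  · rw [map_neg, conj_I, Ph_symm, ← hev]; congr 1
    · linear_combination (-(z1 + z2) / 2 / j) * hI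
    · ring

lemma build (hk4 : k % 4 = 0) (h : Trip k p q r p0) :
    IsHJF k 1 (fun τ z1 z2 => Ph p q r τ ((z1 + z2) / 2) (I * (z1 - z2) / 2)) := by
  have hI : I ^ 2 = -1 := I_sq
  refine ⟨Ph_holo h, ?_, ?_, ?_⟩
  · intro ε hε M τ z1 z2 hτ
    rw [unit_pow hk4 hε]
    have := Ph_transf h M hτ ((z1 + z2) / 2) (I * (z1 - z2) / 2)
    have e := Ph_unit (p := p) (q := q) (r := r) hε (mob M τ) (jf M τ) z1 z2
    refine e.trans (this.trans ?_)
    rw [one_mul]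
    change _ = jf M τ ^ k * eC ((1 : ℕ) * Mc M * z1 * z2 / jf M τ) * _
    congr 3
    push_cast
    rw [show ((z1 + z2) / 2) ^ 2 + (I * (z1 - z2) / 2) ^ 2 = z1 * z2 by
      linear_combination ((z1 - z2) / 2) ^ 2 * hI]
    ring
  · intro a b c d τ z1 z2 hτ
    have e1 : ((z1 + ((a : ℂ) + (b : ℂ) * Complex.I) * τ + ((c : ℂ) + (d : ℂ) * Complex.I)) +
      (z2 + ((a : ℂ) - (b : ℂ) * Complex.I) * τ + ((c : ℂ) - (d : ℂ) * Complex.I))) / 2 =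
      (z1 + z2) / 2 + (a : ℂ) * τ + (c : ℂ) := by ring
    have e2 : I * ((z1 + ((a : ℂ) + (b : ℂ) * Complex.I) * τ + ((c : ℂ) + (d : ℂ) * Complex.I)) -
      (z2 + ((a : ℂ) - (b : ℂ) * Complex.I) * τ + ((c : ℂ) - (d : ℂ) * Complex.I))) / 2 =
      I * (z1 - z2) / 2 + ((-b : ℤ) : ℂ) * τ + ((-d : ℤ) : ℂ) := by
      push_cast
      linear_combination ((b : ℂ) * τ + d) * hI
    have s1 := (Ph_idx (p := p) (q := q) (r := r) hτ (I * (z1 - z2) / 2 + ((-b : ℤ) : ℂ) * τ + ((-d : ℤ) : ℂ))).shift a c ((z1 + z2) / 2)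
    have s2 := (Ph_idx (p := p) (q := q) (r := r) hτ ((z1 + z2) / 2)).shift (-b) (-d) (I * (z1 - z2) / 2)
    beta_reduce at s1 s2 ⊢
    rw [e1, e2, s1, Ph_symm, s2, Ph_symm, ← mul_assoc, ← eC_add]
    congr 2
    push_cast
    linear_combination 0 * hI
  · obtain ⟨C, hC, hs⟩ := Ph_fourier h
    refine ⟨fun n a b => C (n, a, b), fun n a b hn => hC (n, a, b) (by simpa using hn), ?_⟩
    intro τ z1 z2 hτ
    have := hs τ ((z1 + z2) / 2) (I * (z1 - z2) / 2) hτ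
    convert this using 4 with P
    ring

end

open Filter Topology

lemma four_lim {κ : Type} [DecidableEq κ] (c : ℕ × κ → ℂ) (e : κ → ℂ) (x0 : κ) (hc : ∀ x, x ≠ x0 → c (0, x) = 0) (he : e x0 = 0)
    {G : ℂ → ℂ} (hs : ∀ τ, UHP τ → HasSum (fun P : ℕ × κ => c P * eC (P.1 * τ + e P.2)) (G τ)) :
    Tendsto G imInf (𝓝 (c (0, x0))) := by
  have hs' : ∀ τ, UHP τ → HasSum (fun P : ℕ × κ => (c P * eC (e P.2)) * eC (P.1 * τ)) (G τ) := by
    intro τ hτ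
    convert hs τ hτ using 2 with P
    rw [eC_add]; ring
  have h1 := qs_tendsto (fun P : ℕ × κ => c P * eC (e P.2)) (fun P => P.1) ((hs' I (by simp [UHP])).summable.norm)
  have h2 : (∑' P : ℕ × κ, if P.1 = 0 then c P * eC (e P.2) else 0) = c (0, x0) := by
    rw [tsum_eq_single (0, x0)]
    · simp [he, eC_zero]
    · rintro ⟨n, x⟩ hP
      by_cases hn : n = 0
      · subst hn
        have : x ≠ x0 := fun h => hP (by rw [h])
        simp [hc x this]
      · simp [hn]
  rw [h2] at h1
  refine h1.congr' ?_
  filter_upwards [imInf_UHP] with τ hτ using (hs' τ hτ).tsum_eq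

lemma lim_deriv {f : ℂ → ℂ} {c : ℂ} (hf : DifferentiableOn ℂ f {τ | UHP τ}) (hl : Tendsto f imInf (𝓝 c)) :
    Tendsto (deriv f) imInf (𝓝 0) := by
  rw [Metric.tendsto_nhds] at hl ⊢
  intro ε hε
  have h1 := hl (ε / 2) (half_pos hε)
  rw [imInf, Filter.eventually_comap] at h1
  obtain ⟨B, hB⟩ := Filter.eventually_atTop.1 h1
  filter_upwards [imInf_ge (B + 1), imInf_ge 2] with τ h2 h3
  have him : ∀ z ∈ Metric.closedBall τ 1, τ.im - 1 ≤ z.im := by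
    intro z hz
    rw [mem_closedBall_iff_norm] at hz
    have := (Complex.abs_im_le_norm (z - τ)).trans hz
    rw [Complex.sub_im] at this
    linarith [(abs_le.1 this).1]
  have hd : DiffContOnCl ℂ (fun z => f z - c) (Metric.ball τ 1) := by
    apply DifferentiableOn.diffContOnCl
    rw [closure_ball _ one_ne_zero]
    refine (hf.sub_const c).mono fun z hz => ?_
    have := him z hz
    change 0 < z.im
    linarith
  have := Complex.norm_deriv_le_of_forall_mem_sphere_norm_le (C := ε / 2) one_pos hd (fun z hz => by
    have h4 := hB z.im (by linarith [him z (Metric.sphere_subset_closedBall hz)]) z rfl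
    rw [dist_eq_norm] at h4; exact h4.le)
  rw [deriv_sub_const, div_one] at this
  rw [dist_zero_right]; linarith

lemma diff_deriv_UHP {f : ℂ → ℂ} (hf : DifferentiableOn ℂ f {τ | UHP τ}) : DifferentiableOn ℂ (deriv f) {τ | UHP τ} :=
  hf.deriv isOpen_UHP

lemma hasD {f : ℂ → ℂ} (hf : DifferentiableOn ℂ f {τ | UHP τ}) {τ : ℂ} (hτ : UHP τ) : HasDerivAt f (deriv f τ) τ :=
  (hf.differentiableAt (isOpen_UHP.mem_nhds hτ)).hasDerivAt

lemma jf_hasD (M : Matrix.SpecialLinearGroup (Fin 2) ℤ) (τ : ℂ) : HasDerivAt (jf M) (Mc M) τ := by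
  unfold jf
  simpa using ((hasDerivAt_id τ).const_mul (Mc M)).add_const (Md M)

lemma mob_hasD (M : Matrix.SpecialLinearGroup (Fin 2) ℤ) {τ : ℂ} (hτ : UHP τ) :
    HasDerivAt (mob M) ((jf M τ ^ 2)⁻¹) τ := by
  have h1 : HasDerivAt (fun τ => Ma M * τ + Mb M) (Ma M) τ := by
    simpa using ((hasDerivAt_id τ).const_mul (Ma M)).add_const (Mb M)
  have hj := jf_ne M hτ
  have := h1.div (jf_hasD M τ) hj
  have hd := M_det M
  have e : (Ma M * jf M τ - (Ma M * τ + Mb M) * Mc M) / jf M τ ^ 2 = (jf M τ ^ 2)⁻¹ := by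
    rw [← one_div, ← hd]; congr 1; rw [jf]; ring
  rw [e] at this
  exact this

lemma deriv_transf (M : Matrix.SpecialLinearGroup (Fin 2) ℤ) {f F : ℂ → ℂ} (hf : DifferentiableOn ℂ f {τ | UHP τ})
    (h : ∀ τ, UHP τ → f (mob M τ) = F τ) {τ F' : ℂ} (hτ : UHP τ) (hF : HasDerivAt F F' τ) :
    deriv f (mob M τ) = jf M τ ^ 2 * F' := by
  have h1 := (hasD hf (UHP_mob M hτ)).comp τ (mob_hasD M hτ)
  have h2 : HasDerivAt (f ∘ mob M) F' τ := by
    refine hF.congr_of_eventuallyEq ?_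
    filter_upwards [isOpen_UHP.mem_nhds hτ] with t ht using h t ht
  have h3 := h1.unique h2
  have hj := jf_ne M hτ
  rw [← h3]; field_simp

lemma At_ne {τ : ℂ} (hτ : UHP τ) : ∃ u, At τ u ≠ 0 := by
  by_contra! h
  have h1 := c2_At hτ
  rw [show At τ = fun _ => 0 from funext h] at h1
  simp [c2] at h1

lemma At_diff_tau (u : ℂ) : DifferentiableOn ℂ (fun τ => At τ u) {τ | UHP τ} := by
  intro τ hτ
  have g : DifferentiableAt ℂ (fun τ : ℂ => (τ, u)) τ := by fun_prop
  exact (DifferentiableAt.comp τ (At_holo (p := (τ, u)) hτ) g).differentiableWithinAt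
lemma Bt_diff_tau (u : ℂ) : DifferentiableOn ℂ (fun τ => Bt τ u) {τ | UHP τ} := by
  intro τ hτ
  have g : DifferentiableAt ℂ (fun τ : ℂ => (τ, u)) τ := by fun_prop
  exact (DifferentiableAt.comp τ (Bt_holo (p := (τ, u)) hτ) g).differentiableWithinAt

lemma coef_holo {q : ℂ → ℂ} (n : ℕ) {G : ℂ → ℂ → ℂ} (hG : ∀ u, DifferentiableOn ℂ (fun τ => G τ u) {τ | UHP τ})
    (h : ∀ τ u, UHP τ → q τ * At τ u ^ n = G τ u) : DifferentiableOn ℂ q {τ | UHP τ} := by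
  intro τ hτ
  obtain ⟨u, hu⟩ := At_ne hτ
  have hO := isOpen_UHP.mem_nhds hτ
  have hA := (At_diff_tau u).differentiableAt hO
  have hd : DifferentiableAt ℂ (fun t => G t u / At t u ^ n) τ :=
    ((hG u).differentiableAt hO).fun_div (hA.fun_pow n) (pow_ne_zero _ hu)
  refine (hd.congr_of_eventuallyEq ?_).differentiableWithinAt
  filter_upwards [hO, hA.continuousAt.eventually_ne hu] with t ht h0
  rw [← h t u ht, mul_div_cancel_right₀ _ (pow_ne_zero _ h0)]

section
variable {k : ℕ} {ψ : ℂ → ℂ → ℂ}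

lemma JF_idx (h : IsJF k 1 ψ) {τ : ℂ} (hτ : UHP τ) : Idx τ (ψ τ) := by
  refine ⟨?_, ?_, ?_⟩
  · intro u
    have g : DifferentiableAt ℂ (fun u : ℂ => (τ, u)) u := by fun_prop
    have hO : IsOpen {p : ℂ × ℂ | UHP p.1} := isOpen_UHP.preimage continuous_fst
    have h1 := h.holo.differentiableAt (x := (τ, u)) (hO.mem_nhds hτ)
    exact DifferentiableAt.comp u (g := fun p : ℂ × ℂ => ψ p.1 p.2) h1 g
  · intro u
    simpa [eC_zero] using h.ellip 0 1 τ u hτ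
  · intro u
    have := h.ellip 1 0 τ u hτ
    simp at this
    rw [this]; congr 2; ring

lemma JF_tau (h : IsJF k 1 ψ) (u : ℂ) : DifferentiableOn ℂ (fun τ => ψ τ u) {τ | UHP τ} := by
  intro τ hτ
  have g : DifferentiableAt ℂ (fun τ : ℂ => (τ, u)) τ := by fun_prop
  have hO : IsOpen {p : ℂ × ℂ | UHP p.1} := isOpen_UHP.preimage continuous_fst
  exact (DifferentiableAt.comp τ (h.holo.differentiableAt (x := (τ, u)) (hO.mem_nhds hτ)) g).differentiableWithinAt

lemma JF_lim (h : IsJF k 1 ψ) : ∃ c0 : ℂ, ∀ z, Tendsto (fun τ => ψ τ z) imInf (𝓝 c0) := by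
  obtain ⟨c, hc, hs⟩ := h.fourier
  refine ⟨c 0 0, fun z => ?_⟩
  refine four_lim (fun P : ℕ × ℤ => c P.1 P.2) (fun r => r * z) 0 (fun r hr => hc 0 r ?_) (by simp)
    (fun τ hτ => hs τ z hτ)
  have : 0 < r ^ 2 := by positivity
  simpa using this

lemma JF_trip (h : IsJF k 1 ψ) : ∃ p0, Trip k (fun τ => ψ τ 0) (fun τ => c2 (ψ τ))
    (fun τ => 2 * (2 * Real.pi * I) / (k + 2) * deriv (fun τ => c2 (ψ τ)) τ
      - (2 * Real.pi * I) ^ 2 / ((k + 1) * (k + 2)) * deriv (deriv (fun τ => ψ τ 0)) τ) p0 := by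
  obtain ⟨c0, hl⟩ := JF_lim h
  set p : ℂ → ℂ := fun τ => ψ τ 0 with hpdef
  set q : ℂ → ℂ := fun τ => c2 (ψ τ) with hqdef
  have hsp : ∀ τ u, UHP τ → ψ τ u = p τ * Bt τ u + q τ * At τ u := fun τ u hτ => span hτ (JF_idx h hτ) u
  have dp : DifferentiableOn ℂ p {τ | UHP τ} := JF_tau h 0
  have dq : DifferentiableOn ℂ q {τ | UHP τ} := by
    refine coef_holo (q := q) 1 (G := fun τ u => ψ τ u - p τ * Bt τ u) (fun u => ?_) ?_
    · exact (JF_tau h u).fun_sub (dp.fun_mul (Bt_diff_tau u))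
    · intro τ u hτ
      beta_reduce
      rw [hsp τ u hτ]; ring
  have dp1 := diff_deriv_UHP dp
  have dp2 := diff_deriv_UHP dp1
  have dq1 := diff_deriv_UHP dq
  have tp : ∀ M τ, UHP τ → p (mob M τ) = jf M τ ^ k * p τ := by
    intro M τ hτ
    have := h.transf M τ 0 hτ
    simp only [zero_div, mul_zero, ne_eq, OfNat.ofNat_ne_zero, not_false_eq_true, zero_pow, eC_zero, mul_one] at this
    exact this
  have tq : ∀ M τ, UHP τ → q (mob M τ) = jf M τ ^ (k + 2) * (q τ + (2 * Real.pi * I * (Mc M / jf M τ)) * p τ) := by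
    intro M τ hτ
    have hj := jf_ne M hτ
    have hd := (JF_idx h hτ).diff
    have e : (fun u => ψ (mob M τ) ((jf M τ)⁻¹ * u)) = fun u => jf M τ ^ k * (eC (Mc M / jf M τ * u ^ 2) * ψ τ u) := by
      ext u
      have := h.transf M τ u hτ
      rw [← mul_assoc, inv_mul_eq_div]
      rw [show Mc M / jf M τ * u ^ 2 = ((1 : ℕ) : ℂ) * Mc M * u ^ 2 / jf M τ by push_cast; ring]
      exact this
    have e2 := congrArg c2 e
    rw [c2_comp_mul, c2_const_mul, c2_mul (by fun_prop) hd, c2_eC_sq, deriv_eC_sq] at e2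
    simp [eC_zero] at e2
    have e3 : c2 (ψ (mob M τ)) = jf M τ ^ 2 * ((jf M τ ^ 2)⁻¹ * c2 (ψ (mob M τ))) := by field_simp
    simp only [hqdef, hpdef]
    rw [e3, e2]; ring
  have lp : Tendsto p imInf (𝓝 c0) := hl 0
  have lq : Tendsto q imInf (𝓝 0) := by
    have hne : ((2 * Real.pi * I : ℂ) ^ 2)⁻¹ * (-4) ≠ 0 := mul_ne_zero (inv_ne_zero tpi_ne) (by norm_num)
    have h1 := ((hl (1 / 2)).sub (lp.mul Bt_lim)).div At_lim hne
    rw [mul_one, sub_self, zero_div] at h1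
    refine h1.congr' ?_
    filter_upwards [imInf_UHP, At_lim.eventually_ne hne] with τ hτ h0
    simp only [Pi.div_apply]
    rw [hsp τ _ hτ]; field_simp; ring
  refine ⟨c0, dp, dq, ?_, tp, tq, ?_, lp, lq, ?_⟩
  · exact (dq1.const_mul _).fun_sub (dp2.const_mul _)
  · intro M τ hτ
    have hp1 : ∀ t, UHP t → deriv p (mob M t) = jf M t ^ 2 * (k * jf M t ^ (k - 1) * Mc M * p t + jf M t ^ k * deriv p t) :=
      fun t ht => deriv_transf M dp (tp M) ht (((jf_hasD M t).pow k).mul (hasD dp ht))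
    have hp1' : ∀ t, UHP t → deriv p (mob M t) = k * Mc M * (jf M t ^ (k + 1) * p t) + jf M t ^ (k + 2) * deriv p t := by
      intro t ht
      rw [hp1 t ht]
      rcases k with _ | k
      · simp
      · simp only [Nat.add_sub_cancel]; ring
    have hp2 := deriv_transf M dp1 hp1' hτ
      (((((jf_hasD M τ).pow (k + 1)).mul (hasD dp hτ)).const_mul (k * Mc M)).add
        (((jf_hasD M τ).pow (k + 2)).mul (hasD dp1 hτ)))
    have tq' : ∀ t, UHP t → q (mob M t) = jf M t ^ (k + 2) * q t + (2 * Real.pi * I * Mc M) * (jf M t ^ (k + 1) * p t) := by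
      intro t ht
      have hj := jf_ne M ht
      rw [tq M t ht]; field_simp; ring
    have hq1 := deriv_transf M dq tq' hτ
      ((((jf_hasD M τ).pow (k + 2)).mul (hasD dq hτ)).add
        ((((jf_hasD M τ).pow (k + 1)).mul (hasD dp hτ)).const_mul (2 * Real.pi * I * Mc M)))
    have hj := jf_ne M hτ
    have hk1 : (k : ℂ) + 1 ≠ 0 := by exact_mod_cast Nat.succ_ne_zero k
    have hk2 : (k : ℂ) + 2 ≠ 0 := by exact_mod_cast Nat.succ_ne_zero (k + 1)
    beta_reduce
    rw [hp2, hq1]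
    simp only [Nat.add_sub_cancel, Pi.pow_apply, show k + 2 - 1 = k + 1 from rfl]
    push_cast
    generalize (2 * Real.pi * I : ℂ) = s
    field_simp
    ring
  · have := ((lim_deriv dq lq).const_mul (2 * (2 * Real.pi * I) / (k + 2) : ℂ)).sub
      ((lim_deriv dp1 (lim_deriv dp lp)).const_mul ((2 * Real.pi * I) ^ 2 / ((k + 1) * (k + 2)) : ℂ))
    simpa using this

lemma part1 (hk4 : k % 4 = 0) (h : IsJF k 1 ψ) :
    ∃ φ : ℂ → ℂ → ℂ → ℂ, IsHJF k 1 φ ∧ ∀ τ z : ℂ, UHP τ → φ τ z z = ψ τ z := by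
  obtain ⟨p0, ht⟩ := JF_trip h
  refine ⟨_, build hk4 ht, fun τ z hτ => ?_⟩
  simp only [Ph]
  rw [span hτ (JF_idx h hτ) z]
  rw [sub_self, mul_zero, zero_div, show (z + z) / 2 = z by ring, At_zero, Bt_zero hτ]
  ring

end

open Filter Topology

lemma iter2 (f : ℂ → ℂ) : iteratedDeriv 2 f 0 = 2 * c2 f := by
  rw [iteratedDeriv_eq_iterate, c2]
  simp only [Function.iterate_succ, Function.iterate_zero, Function.comp, id]; ring
lemma iter4 (f : ℂ → ℂ) : iteratedDeriv 4 f 0 = 2 * c2 (deriv (deriv f)) := by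
  rw [iteratedDeriv_eq_iterate, c2]
  simp only [Function.iterate_succ, Function.iterate_zero, Function.comp, id]; ring

section
variable {F G : ℂ → ℂ}

lemma c2_FG (hF : Differentiable ℂ F) (hG : Differentiable ℂ G) (F0 : F 0 = 0) (F1 : deriv F 0 = 0)
    (G0 : G 0 = 0) (G1 : deriv G 0 = 0) (s : ℂ) :
    c2 (fun z => deriv (deriv F) z / 2 * G z + (s * (deriv F z * deriv G z) + F z * (deriv (deriv G) z / 2)))
      = (2 + 4 * s) * (c2 F * c2 G) := by
  have dF := diff_deriv hF
  have dG := diff_deriv hG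
  have ddF := diff_deriv dF
  have ddG := diff_deriv dG
  have h1 : c2 (fun z => deriv (deriv F) z / 2 * G z) = c2 F * c2 G := by
    rw [c2_mul (by fun_prop) hG, G0, G1, ← c2]; ring
  have h2 : c2 (fun z => F z * (deriv (deriv G) z / 2)) = c2 F * c2 G := by
    rw [c2_mul hF (by fun_prop), F0, F1, ← c2]; ring
  have h3 : c2 (fun z => deriv F z * deriv G z) = 4 * (c2 F * c2 G) := by
    rw [c2_mul dF dG, F1, G1]; simp only [c2]; ring
  rw [c2_add (by fun_prop) (by fun_prop), c2_add (by fun_prop) (by fun_prop), c2_const_mul, h1, h2, h3]; ring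

lemma dd_FG (hF : Differentiable ℂ F) (hG : Differentiable ℂ G) (z : ℂ) :
    deriv (deriv (fun z => F z * G z)) z =
      2 * (deriv (deriv F) z / 2 * G z + (1 * (deriv F z * deriv G z) + F z * (deriv (deriv G) z / 2))) := by
  have h1 : deriv (fun u => F u * G u) = fun u => deriv F u * G u + F u * deriv G u := by
    ext u; exact deriv_fun_mul (hF u) (hG u)
  rw [h1, deriv_fun_add ((diff_deriv hF z).fun_mul (hG z)) ((hF z).fun_mul (diff_deriv hG z)),
    deriv_fun_mul (diff_deriv hF z) (hG z), deriv_fun_mul (hF z) (diff_deriv hG z)]; ring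

lemma iter4_FG (hF : Differentiable ℂ F) (hG : Differentiable ℂ G) (F0 : F 0 = 0) (F1 : deriv F 0 = 0)
    (G0 : G 0 = 0) (G1 : deriv G 0 = 0) :
    iteratedDeriv 4 (fun z => F z * G z) 0 = 24 * (c2 F * c2 G) := by
  rw [iter4, show deriv (deriv (fun z => F z * G z)) = _ from funext (dd_FG hF hG), c2_const_mul,
    c2_FG hF hG F0 F1 G0 G1]; ring

lemma inner2 (hF : Differentiable ℂ F) (hG : Differentiable ℂ G) (z : ℂ) :
    iteratedDeriv 2 (fun w => F (z + w) * G (z - w)) 0 =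
      2 * (deriv (deriv F) z / 2 * G z + (-1 * (deriv F z * deriv G z) + F z * (deriv (deriv G) z / 2))) := by
  have e1 : deriv (fun w => F (z + w)) = fun w => deriv F (z + w) := by
    ext w; exact deriv_comp_const_add F z w
  have e2 : deriv (fun w => G (z - w)) = fun w => -deriv G (z - w) := by
    ext w; exact deriv_comp_const_sub G z w
  have e3 : deriv (fun w => -deriv G (z - w)) 0 = deriv (deriv G) z := by
    rw [deriv.fun_neg, deriv_comp_const_sub]; simp
  rw [iter2, c2_mul (by fun_prop) (by fun_prop), c2, c2, e1, e2, e3, deriv_comp_const_add]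
  simp only [add_zero, sub_zero]; ring

lemma iter22 (hF : Differentiable ℂ F) (hG : Differentiable ℂ G) (F0 : F 0 = 0) (F1 : deriv F 0 = 0)
    (G0 : G 0 = 0) (G1 : deriv G 0 = 0) :
    iteratedDeriv 2 (fun z => iteratedDeriv 2 (fun w => F (z + w) * G (z - w)) 0) 0 = -8 * (c2 F * c2 G) := by
  rw [show (fun z => iteratedDeriv 2 (fun w => F (z + w) * G (z - w)) 0) = _ from funext (inner2 hF hG), iter2,
    c2_const_mul, c2_FG hF hG F0 F1 G0 G1]; ring

lemma iter11 (hF : Differentiable ℂ F) (hG : Differentiable ℂ G) (F0 : F 0 = 0) (F1 : deriv F 0 = 0)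
    (G0 : G 0 = 0) (G1 : deriv G 0 = 0) :
    iteratedDeriv 1 (fun z => iteratedDeriv 1 (fun w => F (z + w) * G (z - w)) 0) 0 = 0 := by
  have dF := diff_deriv hF
  have dG := diff_deriv hG
  have e : (fun z => iteratedDeriv 1 (fun w => F (z + w) * G (z - w)) 0) =
      fun z => deriv F z * G z - F z * deriv G z := by
    ext z
    rw [iteratedDeriv_one, deriv_fun_mul (by fun_prop) (by fun_prop), deriv_comp_const_add, deriv_comp_const_sub]
    simp; ring
  rw [e, iteratedDeriv_one, deriv_fun_sub (by fun_prop) (by fun_prop), deriv_fun_mul (by fun_prop) (by fun_prop),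
    deriv_fun_mul (by fun_prop) (by fun_prop), F0, F1, G0, G1]; ring

end

/-- formula for Xi on products -/
lemma Xi_eq (k : ℕ) {φ : ℂ → ℂ → ℂ → ℂ} {r : ℂ → ℂ}
    (h : ∀ τ z1 z2, UHP τ → φ τ z1 z2 = r τ * (At τ ((z1 + z2) / 2) * At τ (I * (z1 - z2) / 2)))
    {τ : ℂ} (hτ : UHP τ) : XiMap k φ τ = 7 / 8 * r τ := by
  have key : ∀ t, UHP t → chiHJF φ 2 2 t = r t / 8 ∧ chiHJF φ 4 0 t = - r t / 16 ∧ chiHJF φ 0 4 t = - r t / 16 ∧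
      chiHJF φ 1 1 t = 0 ∧ chiHJF φ 0 0 t = 0 := by
    intro t ht
    have hA := (At_idx ht).diff
    have hA1 : deriv (At t) 0 = 0 := deriv_even (At_even t)
    obtain ⟨F, hFd⟩ : ∃ F : ℂ → ℂ, F = fun z => At t (1 / 2 * z) := ⟨_, rfl⟩
    obtain ⟨G, hGd⟩ : ∃ G : ℂ → ℂ, G = fun z => At t (I / 2 * z) := ⟨_, rfl⟩
    have hF : Differentiable ℂ F := by rw [hFd]; fun_prop
    have hG : Differentiable ℂ G := by rw [hGd]; fun_prop
    have F0 : F 0 = 0 := by rw [hFd]; simp [At_zero]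
    have G0 : G 0 = 0 := by rw [hGd]; simp [At_zero]
    have Gev : ∀ z, G (-z) = G z := fun z => by
      rw [hGd]; simp only [mul_neg, At_even]
    have F1 : deriv F 0 = 0 := deriv_even fun z => by
      rw [hFd]; simp only [mul_neg, At_even]
    have G1 : deriv G 0 = 0 := deriv_even Gev
    have F2 : c2 F = 1 / 4 := by rw [hFd, c2_comp_mul, c2_At ht]; norm_num
    have G2 : c2 G = -1 / 4 := by rw [hGd, c2_comp_mul, c2_At ht, div_pow, I_sq]; norm_num
    have hφ : ∀ z w, φ t z w = r t * (F (z + w) * G (z - w)) := by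
      intro z w
      rw [h t z w ht, hFd, hGd]; simp only []
      rw [show (z + w) / 2 = 1 / 2 * (z + w) by ring, show I * (z - w) / 2 = I / 2 * (z - w) by ring]
    have e22 := iter22 hF hG F0 F1 G0 G1
    have e11 := iter11 hF hG F0 F1 G0 G1
    have e4 := iter4_FG hF hG F0 F1 G0 G1
    rw [F2, G2] at e22 e4
    refine ⟨?_, ?_, ?_, ?_, ?_⟩
    · simp only [chiHJF, hφ, iteratedDeriv_const_mul_field]
      rw [e22]; norm_num [Nat.factorial]; ring
    · simp only [chiHJF, hφ, iteratedDeriv_zero, iteratedDeriv_const_mul_field, add_zero, sub_zero]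
      rw [e4]; norm_num [Nat.factorial]; ring
    · simp only [chiHJF, hφ, iteratedDeriv_zero, iteratedDeriv_const_mul_field, zero_add, zero_sub, Gev]
      rw [e4]; norm_num [Nat.factorial]; ring
    · simp only [chiHJF, hφ, iteratedDeriv_const_mul_field]
      rw [e11]; ring
    · simp only [chiHJF, hφ, iteratedDeriv_zero, add_zero, sub_zero, F0]; ring
  obtain ⟨k1, k2, k3, -, -⟩ := key τ hτ
  have z1 : chiHJF φ 1 1 =ᶠ[𝓝 τ] fun _ => 0 := by
    filter_upwards [isOpen_UHP.mem_nhds hτ] with t ht using (key t ht).2.2.2.1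
  have z0 : chiHJF φ 0 0 =ᶠ[𝓝 τ] fun _ => 0 := by
    filter_upwards [isOpen_UHP.mem_nhds hτ] with t ht using (key t ht).2.2.2.2
  have d1 := z1.deriv_eq
  have d0 := z0.deriv.deriv_eq
  rw [XiMap, k1, k2, k3, d1, d0]
  simp only [deriv_const', deriv_const]; ring

section
variable {k : ℕ} {φ : ℂ → ℂ → ℂ → ℂ}

lemma isOpen3 : IsOpen {p : ℂ × ℂ × ℂ | UHP p.1} := isOpen_UHP.preimage continuous_fst

lemma ker_form (hk4 : k % 4 = 0) (h : IsHJF k 1 φ) (h0 : ∀ τ z : ℂ, UHP τ → φ τ z z = 0) :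
    ∃ r : ℂ → ℂ, ∀ τ z1 z2, UHP τ → φ τ z1 z2 = r τ * (At τ ((z1 + z2) / 2) * At τ (I * (z1 - z2) / 2)) := by
  have hI : I ^ 2 = -1 := I_sq
  refine ⟨fun τ => c2 (fun v => c2 (fun u => φ τ (u - I * v) (u + I * v))), fun τ z1 z2 hτ => ?_⟩
  obtain ⟨Φ, hΦ⟩ : ∃ Φ : ℂ → ℂ → ℂ, Φ = fun u v => φ τ (u - I * v) (u + I * v) := ⟨_, rfl⟩
  have hdiff : Differentiable ℂ (fun x : ℂ × ℂ => Φ x.1 x.2) := by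
    intro x
    have g : DifferentiableAt ℂ (fun x : ℂ × ℂ => (τ, x.1 - I * x.2, x.1 + I * x.2)) x := by fun_prop
    have h1 := h.holo.differentiableAt (x := (τ, x.1 - I * x.2, x.1 + I * x.2)) (isOpen3.mem_nhds hτ)
    rw [hΦ]
    exact DifferentiableAt.comp x (g := fun p : ℂ × ℂ × ℂ => φ p.1 p.2.1 p.2.2) h1 g
  have i1 : ∀ v, Idx τ (fun u => Φ u v) := by
    intro v
    refine ⟨?_, fun u => ?_, fun u => ?_⟩
    · intro u
      have g : DifferentiableAt ℂ (fun u : ℂ => (u, v)) u := by fun_prop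
      exact DifferentiableAt.comp u (g := fun x : ℂ × ℂ => Φ x.1 x.2) (hdiff (u, v)) g
    · have := h.ellip 0 0 1 0 τ (u - I * v) (u + I * v) hτ
      simp [eC_zero] at this
      rw [hΦ]; beta_reduce
      rw [← this]; congr 1 <;> ring
    · have := h.ellip 1 0 0 0 τ (u - I * v) (u + I * v) hτ
      simp at this
      rw [hΦ]; beta_reduce
      rw [show u + τ - I * v = u - I * v + τ by ring, show u + τ + I * v = u + I * v + τ by ring, this]
      congr 2; ring
  have i2 : ∀ u, Idx τ (fun v => Φ u v) := by
    intro u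
    refine ⟨?_, fun v => ?_, fun v => ?_⟩
    · intro v
      have g : DifferentiableAt ℂ (fun v : ℂ => (u, v)) v := by fun_prop
      exact DifferentiableAt.comp v (g := fun x : ℂ × ℂ => Φ x.1 x.2) (hdiff (u, v)) g
    · have := h.ellip 0 0 0 (-1) τ (u - I * v) (u + I * v) hτ
      simp [eC_zero] at this
      rw [hΦ]; beta_reduce
      rw [← this]; congr 1 <;> ring
    · have := h.ellip 0 (-1) 0 0 τ (u - I * v) (u + I * v) hτ
      simp at this
      rw [hΦ]; beta_reduce
      rw [show u - I * (v + τ) = u - I * v + -(I * τ) by ring, show u + I * (v + τ) = u + I * v + I * τ by ring, this]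
      congr 2; linear_combination (2 * v) * hI
  have hu0 : ∀ u, Φ u 0 = 0 := fun u => by rw [hΦ]; simp [h0 τ u hτ]
  have hv0 : ∀ v, Φ 0 v = 0 := by
    intro v
    have := h.transf I (by simp) 1 τ (-(I * v)) (I * v) hτ
    rw [unit_pow hk4 (by simp)] at this
    simp [Ma, Mb, Mc, Md, eC_zero] at this
    rw [hΦ]; simp only [zero_sub, zero_add]
    rw [← this, ← h0 τ v hτ]
    congr 1 <;> linear_combination (-v) * hI
  have s1 : ∀ u v, Φ u v = At τ u * c2 (fun u => Φ u v) := by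
    intro u v
    have := span hτ (i1 v) u
    beta_reduce at this
    rw [this, hv0]; ring
  have s2 : ∀ u v, Φ u v = At τ u * c2 (fun v => c2 (fun u => Φ u v)) * At τ v := by
    intro u v
    have := span hτ (i2 u) v
    beta_reduce at this
    rw [this, hu0, show (fun v => Φ u v) = _ from funext (s1 u), c2_const_mul]; ring
  have := s2 ((z1 + z2) / 2) (I * (z1 - z2) / 2)
  rw [hΦ] at this
  beta_reduce at this
  rw [show (z1 + z2) / 2 - I * (I * (z1 - z2) / 2) = z1 by linear_combination (-(z1 - z2) / 2) * hI,
    show (z1 + z2) / 2 + I * (I * (z1 - z2) / 2) = z2 by linear_combination ((z1 - z2) / 2) * hI] at this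
  rw [this]; ring

lemma part2 (h : IsHJF k 1 φ) (h0 : ∀ τ z : ℂ, UHP τ → φ τ z z = 0) {r : ℂ → ℂ}
    (hr : ∀ τ z1 z2, UHP τ → φ τ z1 z2 = r τ * (At τ ((z1 + z2) / 2) * At τ (I * (z1 - z2) / 2))) :
    IsCF (k + 4) (XiMap k φ) := by
  have hI : I ^ 2 = -1 := I_sq
  have hru : ∀ τ u, UHP τ → r τ * At τ u ^ 2 = φ τ (u - I * u) (u + I * u) := by
    intro τ u hτ
    rw [hr τ _ _ hτ, show (u - I * u + (u + I * u)) / 2 = u by ring,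
      show I * (u - I * u - (u + I * u)) / 2 = u by linear_combination (-u) * hI]; ring
  have hX : ∀ τ, UHP τ → XiMap k φ τ = 7 / 8 * r τ := fun τ hτ => Xi_eq k hr hτ
  have hd : DifferentiableOn ℂ r {τ | UHP τ} := by
    refine coef_holo 2 (G := fun τ u => φ τ (u - I * u) (u + I * u)) (fun u τ hτ => ?_) hru
    have g : DifferentiableAt ℂ (fun τ : ℂ => (τ, u - I * u, u + I * u)) τ := by fun_prop
    have h1 := h.holo.differentiableAt (x := (τ, u - I * u, u + I * u)) (isOpen3.mem_nhds hτ)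
    exact (DifferentiableAt.comp τ (g := fun p : ℂ × ℂ × ℂ => φ p.1 p.2.1 p.2.2) h1 g).differentiableWithinAt
  refine ⟨(hd.const_mul (7 / 8)).congr hX, ?_, ?_⟩
  · intro M τ hτ
    change XiMap k φ (mob M τ) = jf M τ ^ (k + 4) * _
    rw [hX _ hτ, hX _ (UHP_mob M hτ)]
    obtain ⟨u, hu⟩ := At_ne hτ
    have hj := jf_ne M hτ
    have e1 := h.transf 1 (by simp) M τ (u - I * u) (u + I * u) hτ
    rw [one_pow, one_mul, one_mul, map_one, one_mul] at e1
    change φ (mob M τ) ((u - I * u) / jf M τ) ((u + I * u) / jf M τ) =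
      jf M τ ^ k * eC ((1 : ℕ) * Mc M * (u - I * u) * (u + I * u) / jf M τ) * _ at e1
    have e2 := hru (mob M τ) (u / jf M τ) (UHP_mob M hτ)
    rw [show u / jf M τ - I * (u / jf M τ) = (u - I * u) / jf M τ by ring,
      show u / jf M τ + I * (u / jf M τ) = (u + I * u) / jf M τ by ring, e1, ← hru τ u hτ, At_transf M hτ,
      show (((1 : ℕ) : ℂ) * Mc M * (u - I * u) * (u + I * u) / jf M τ) = Mc M / jf M τ * u ^ 2 + Mc M / jf M τ * u ^ 2 by
        push_cast; linear_combination (-Mc M / jf M τ * u ^ 2) * hI, eC_add] at e2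
    have hE := eC_ne_zero (Mc M / jf M τ * u ^ 2)
    set E := eC (Mc M / jf M τ * u ^ 2)
    have hne : (jf M τ ^ 4)⁻¹ * E ^ 2 * At τ u ^ 2 ≠ 0 := by positivity
    apply mul_right_cancel₀ hne
    have e3 : jf M τ ^ (k + 4) = jf M τ ^ k * jf M τ ^ 4 := pow_add _ _ _
    have e4 : jf M τ ^ 4 * (jf M τ ^ 4)⁻¹ = 1 := mul_inv_cancel₀ (pow_ne_zero _ hj)
    rw [e3]
    have e5 : ((jf M τ ^ 2)⁻¹) ^ 2 = (jf M τ ^ 4)⁻¹ := by rw [inv_pow, ← pow_mul]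
    linear_combination (7 / 8) * e2 - (7 / 8 * r (mob M τ) * E ^ 2 * At τ u ^ 2) * e5 -
      (7 / 8 * jf M τ ^ k * r τ * E ^ 2 * At τ u ^ 2) * e4
  · obtain ⟨c, hc, hs⟩ := h.fourier
    have lim : ∀ z1 z2, Tendsto (fun τ => φ τ z1 z2) imInf (𝓝 (c 0 0 0)) := by
      intro z1 z2
      refine four_lim (fun P : ℕ × ℤ × ℤ => c P.1 P.2.1 P.2.2)
        (fun x => (((x.1 : ℂ) + (x.2 : ℂ) * Complex.I) / 2) * z1 + (((x.1 : ℂ) - (x.2 : ℂ) * Complex.I) / 2) * z2) (0, 0)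
        (fun x hx => hc 0 x.1 x.2 ?_) (by simp) (fun τ hτ => ?_)
      · have : x.1 ≠ 0 ∨ x.2 ≠ 0 := by
          by_contra! hh
          exact hx (Prod.ext hh.1 hh.2)
        have : 0 < x.1 ^ 2 + x.2 ^ 2 := by
          rcases this with h | h <;> positivity
        simpa using this
      · convert hs τ z1 z2 hτ using 4
        rw [add_assoc]
    have hc0 : c 0 0 0 = 0 := by
      refine tendsto_nhds_unique (lim 0 0) (tendsto_const_nhds.congr' ?_)
      filter_upwards [imInf_UHP] with τ hτ using (h0 τ 0 hτ).symm
    rw [hc0] at lim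
    have hne : ((2 * Real.pi * I : ℂ) ^ 2)⁻¹ * (-4) ≠ 0 := mul_ne_zero (inv_ne_zero tpi_ne) (by norm_num)
    have h1 := ((lim (1 / 2 - I * (1 / 2)) (1 / 2 + I * (1 / 2))).div (At_lim.pow 2) (pow_ne_zero 2 hne)).const_mul (7 / 8)
    rw [zero_div, mul_zero] at h1
    have h2 : Tendsto (XiMap k φ) imInf (𝓝 0) := by
      refine h1.congr' ?_
      filter_upwards [imInf_UHP, At_lim.eventually_ne hne] with τ hτ hA
      rw [hX τ hτ]
      simp only [Pi.div_apply]
      rw [← hru τ _ hτ, mul_div_cancel_right₀ _ (pow_ne_zero 2 hA)]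
    intro ε hε
    have h3 := (Metric.tendsto_nhds.1 h2) ε hε
    rw [imInf, Filter.eventually_comap] at h3
    obtain ⟨B, hB⟩ := Filter.eventually_atTop.1 h3
    refine ⟨B, fun τ hτ => ?_⟩
    have := hB τ.im hτ τ rfl
    rw [dist_zero_right] at this
    exact this.le

lemma part4 (hk4 : k % 4 = 0) {f : ℂ → ℂ} (hf : IsCF (k + 4) f) :
    ∃ φ : ℂ → ℂ → ℂ → ℂ, IsHJF k 1 φ ∧ (∀ τ z : ℂ, UHP τ → φ τ z z = 0) ∧
        ∀ τ : ℂ, UHP τ → XiMap k φ τ = f τ := by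
  have ht : Trip k (fun _ => 0) (fun _ => 0) (fun τ => 8 / 7 * f τ) 0 := by
    refine ⟨differentiableOn_const 0, differentiableOn_const 0, hf.holo.const_mul _, ?_, ?_, ?_, tendsto_const_nhds,
      tendsto_const_nhds, ?_⟩
    · intro M τ hτ; simp
    · intro M τ hτ; simp
    · intro M τ hτ
      have : f (mob M τ) = jf M τ ^ (k + 4) * f τ := hf.transf M τ hτ
      rw [this]; ring
    · have : Tendsto f imInf (𝓝 0) := by
        rw [Metric.tendsto_nhds]
        intro ε hε
        obtain ⟨B, hB⟩ := hf.decay (ε / 2) (half_pos hε)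
        filter_upwards [imInf_ge B] with τ hτ
        rw [dist_zero_right]
        linarith [hB τ hτ]
      simpa using this.const_mul (8 / 7 : ℂ)
  refine ⟨_, build hk4 ht, fun τ z hτ => ?_, fun τ hτ => ?_⟩
  · simp only [Ph]
    rw [sub_self, mul_zero, zero_div, At_zero]; ring
  · rw [Xi_eq k (r := fun τ => 8 / 7 * f τ) (fun τ z1 z2 _ => by simp only [Ph]; ring) hτ]
    ring

end

/-- for `k ≡ 0 (mod 4)`, `π₁ : J_{k,1}(O_K) → J_{k,1}` is surjective and
`XiMap` restricts to an isomorphism `ker π₁ ≅ S_{k+4}`; in particular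
`0 → S_{k+4} → J_{k,1}(O_K) → J_{k,1} → 0` is exact. -/
theorem stmt6 (k : ℕ) (hk : 0 < k) (hk4 : k % 4 = 0) :
    (∀ ψ : ℂ → ℂ → ℂ, IsJF k 1 ψ →
      ∃ φ : ℂ → ℂ → ℂ → ℂ, IsHJF k 1 φ ∧ ∀ τ z : ℂ, UHP τ → φ τ z z = ψ τ z) ∧
    (∀ φ : ℂ → ℂ → ℂ → ℂ, IsHJF k 1 φ → (∀ τ z : ℂ, UHP τ → φ τ z z = 0) →
      IsCF (k + 4) (XiMap k φ)) ∧
    (∀ φ φ' : ℂ → ℂ → ℂ → ℂ, IsHJF k 1 φ → IsHJF k 1 φ' →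
      (∀ τ z : ℂ, UHP τ → φ τ z z = 0) → (∀ τ z : ℂ, UHP τ → φ' τ z z = 0) →
      (∀ τ : ℂ, UHP τ → XiMap k φ τ = XiMap k φ' τ) →
      ∀ τ z₁ z₂ : ℂ, UHP τ → φ τ z₁ z₂ = φ' τ z₁ z₂) ∧
    (∀ f : ℂ → ℂ, IsCF (k + 4) f →
      ∃ φ : ℂ → ℂ → ℂ → ℂ, IsHJF k 1 φ ∧ (∀ τ z : ℂ, UHP τ → φ τ z z = 0) ∧
        ∀ τ : ℂ, UHP τ → XiMap k φ τ = f τ) := by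
  refine ⟨fun ψ h => part1 hk4 h, ?_, ?_, fun f hf => part4 hk4 hf⟩
  · intro φ h h0
    obtain ⟨r, hr⟩ := ker_form hk4 h h0
    exact part2 h h0 hr
  · intro φ φ' h h' h0 h0' hX τ z₁ z₂ hτ
    obtain ⟨r, hr⟩ := ker_form hk4 h h0
    obtain ⟨r', hr'⟩ := ker_form hk4 h' h0'
    have e := hX τ hτ
    rw [Xi_eq k hr hτ, Xi_eq k hr' hτ] at e
    have e' : r τ = r' τ := by linear_combination (8 / 7) * e
    rw [hr τ z₁ z₂ hτ, hr' τ z₁ z₂ hτ, e']
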